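/- arXiv:2404.18295 — 13 statements merged into one kernel-verified Lean document; each statement's English description precedes it below -/
import Mathlib

section
/- Let L > 0. Let f₁ : [0,∞) → ℂ be locally absolutely continuous with f₁' ∈ L²(0,∞), and let f₂ ∈ H¹(0,L) satisfy f₁(0) = f₂(0) = f₂(L). Then for every ε > 0 there exist g₁ with g₁, g₁' ∈ L²(0,∞) and g₂ ∈ H¹(0,L) satisfying g₁(0) = g₂(0) = g₂(L), such that ‖f₁' − g₁'‖²_{L²(0,∞)} + ‖f₂' − g₂'‖²_{L²(0,L)} ≤ ε². (In other words, H¹(ℛ) is dense in the homogeneous space Ḣ¹(ℛ) for the seminorm ‖f‖² = ‖f₁'‖²_{L²(0,∞)} + ‖f₂'‖²_{L²(0,L)}.) -/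
open MeasureTheory Set

lemma aestronglyMeasurable_of_hasDerivAt_Ioi {f f' : ℝ → ℂ} {a : ℝ}
    (hf : ∀ x ∈ Ioi a, HasDerivAt f (f' x) x) :
    AEStronglyMeasurable f' (volume.restrict (Ioi a)) := by
  refine (measurable_deriv f).aestronglyMeasurable.congr ?_
  filter_upwards [ae_restrict_mem measurableSet_Ioi] with x hx using (hf x hx).deriv

/-- A function with square-integrable derivative on a half-line is Hölder continuous of
exponent `1/2`, by the Cauchy–Schwarz inequality. -/
lemma norm_sub_sq_le_mul_integral_norm_deriv_sq {f f' : ℝ → ℂ} {a b : ℝ} (hab : a ≤ b)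
    (hc : ContinuousOn f (Ici a)) (hf : ∀ x ∈ Ioi a, HasDerivAt f (f' x) x)
    (hf' : IntegrableOn (fun x => ‖f' x‖ ^ 2) (Ioi a)) :
    ‖f b - f a‖ ^ 2 ≤ (∫ x in Ioi a, ‖f' x‖ ^ 2) * (b - a) := by
  have hsub : Ioc a b ⊆ Ioi a := Ioc_subset_Ioi_self
  have hsq : IntegrableOn (fun x => ‖f' x‖ ^ 2) (Ioc a b) := hf'.mono_set hsub
  have hmeas : AEStronglyMeasurable f' (volume.restrict (Ioc a b)) :=
    (aestronglyMeasurable_of_hasDerivAt_Ioi hf).mono_set hsub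
  have hone : IntegrableOn (fun _ : ℝ => (1 : ℝ)) (Ioc a b) := by simp
  have hint : IntegrableOn f' (Ioc a b) := by
    refine (hsq.add hone).mono' hmeas (.of_forall fun x => ?_)
    simp only [Pi.add_apply]
    nlinarith [sq_nonneg (‖f' x‖ - 1), norm_nonneg (f' x)]
  have hftc : ∫ x in a..b, f' x = f b - f a :=
    intervalIntegral.integral_eq_sub_of_hasDerivAt_of_le hab (hc.mono Icc_subset_Ici_self)
      (fun x hx => hf x hx.1) ((intervalIntegrable_iff_integrableOn_Ioc_of_le hab).2 hint)
  rw [intervalIntegral.integral_of_le hab] at hftc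
  have hnorm : ‖f b - f a‖ ≤ ∫ x in Ioc a b, ‖f' x‖ :=
    hftc ▸ norm_integral_le_integral_norm _
  have hmono : ∫ x in Ioc a b, ‖f' x‖ ^ 2 ≤ ∫ x in Ioi a, ‖f' x‖ ^ 2 :=
    setIntegral_mono_set hf' (.of_forall fun x => by positivity) hsub.eventuallyLE
  have hcs : (∫ x in Ioc a b, ‖f' x‖) ^ 2 ≤ (∫ x in Ioc a b, ‖f' x‖ ^ 2) * (b - a) := by
    have hquad : ∀ s : ℝ, 0 ≤ (∫ x in Ioc a b, ‖f' x‖ ^ 2) * (s * s)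
        + (-2 * ∫ x in Ioc a b, ‖f' x‖) * s + (b - a) := by
      intro s
      have hnonneg : 0 ≤ ∫ x in Ioc a b, (s * ‖f' x‖ - 1) ^ 2 :=
        integral_nonneg fun x => sq_nonneg _
      have hexpand : ∫ x in Ioc a b, (s * ‖f' x‖ - 1) ^ 2
          = ∫ x in Ioc a b, ((s ^ 2 * ‖f' x‖ ^ 2 - (2 * s) * ‖f' x‖) + 1) := by
        congr 1; ext x; ring
      have hlin : IntegrableOn (fun x => s ^ 2 * ‖f' x‖ ^ 2 - (2 * s) * ‖f' x‖) (Ioc a b) :=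
        (hsq.const_mul _).sub (hint.norm.const_mul _)
      rw [hexpand, integral_add hlin hone,
        integral_sub (hsq.const_mul _) (hint.norm.const_mul _), integral_const_mul,
        integral_const_mul] at hnonneg
      simp [hab] at hnonneg
      linarith
    have := discrim_le_zero hquad
    unfold discrim at this
    linarith
  calc ‖f b - f a‖ ^ 2 ≤ (∫ x in Ioc a b, ‖f' x‖) ^ 2 := by gcongr
    _ ≤ _ := hcs
    _ ≤ _ := mul_le_mul_of_nonneg_right hmono (by linarith)

/-- A function on `[0,∞)` with square-integrable derivative satisfies `|f x|² = o(x)` at infinity. -/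
lemma exists_norm_sq_le_add_mul {f f' : ℝ → ℂ} (hc : ContinuousOn f (Ici 0))
    (hf : ∀ x ∈ Ioi (0 : ℝ), HasDerivAt f (f' x) x)
    (hf' : IntegrableOn (fun x => ‖f' x‖ ^ 2) (Ioi 0)) {η : ℝ} (hη : 0 < η) :
    ∃ C, 0 ≤ C ∧ ∀ x, 0 ≤ x → ‖f x‖ ^ 2 ≤ C + η * x := by
  obtain ⟨R, hR0, hR⟩ : ∃ R, 0 ≤ R ∧ ∫ x in Ioi R, ‖f' x‖ ^ 2 ≤ η / 2 := by
    have hlim := intervalIntegral_tendsto_integral_Ioi 0 hf' Filter.tendsto_id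
    have hev := hlim.eventually (lt_mem_nhds (sub_lt_self _ (half_pos hη)))
    obtain ⟨R, hR, hR0⟩ := (hev.and (Filter.eventually_ge_atTop 0)).exists
    refine ⟨R, hR0, ?_⟩
    have hsplit := intervalIntegral.integral_interval_add_Ioi (μ := volume) hf'
      (hf'.mono_set (Ioi_subset_Ioi hR0))
    simp only [id] at hR
    linarith
  obtain ⟨M, hM⟩ := (isCompact_Icc (a := (0 : ℝ)) (b := R)).exists_bound_of_continuousOn
    (hc.mono Icc_subset_Ici_self)
  have hM0 : 0 ≤ M := (norm_nonneg _).trans (hM 0 ⟨le_rfl, hR0⟩)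
  refine ⟨2 * M ^ 2, by positivity, fun x hx => ?_⟩
  rcases le_total x R with hxR | hRx
  · have := pow_le_pow_left₀ (norm_nonneg _) (hM x ⟨hx, hxR⟩) 2
    nlinarith [mul_nonneg hη.le hx, sq_nonneg M]
  · have hinc := norm_sub_sq_le_mul_integral_norm_deriv_sq hRx
      (hc.mono (Ici_subset_Ici.2 hR0)) (fun y hy => hf y (hR0.trans_lt hy))
      (hf'.mono_set (Ioi_subset_Ioi hR0))
    have hinc' : ‖f x - f R‖ ^ 2 ≤ η / 2 * x :=
      hinc.trans (mul_le_mul hR (by linarith) (by linarith) (by positivity))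
    have hMR := pow_le_pow_left₀ (norm_nonneg _) (hM R ⟨hR0, le_rfl⟩) 2
    have htri : ‖f x‖ ≤ ‖f x - f R‖ + ‖f R‖ := by simpa using norm_add_le (f x - f R) (f R)
    have := pow_le_pow_left₀ (norm_nonneg _) htri 2
    nlinarith [sq_nonneg (‖f x - f R‖ - ‖f R‖)]

lemma mul_exp_neg_sq_le {C η δ x y : ℝ} (hC : 0 ≤ C) (hη : 0 ≤ η) (hδ : 0 < δ) (hx : 0 ≤ x)
    (hy : y ≤ C + η * x) :
    Real.exp (-δ * x) ^ 2 * y ≤ (C + η / δ) * Real.exp (-δ * x) := by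
  set e := Real.exp (-δ * x) with he
  have he0 : 0 < e := Real.exp_pos _
  have he1 : e ≤ 1 := Real.exp_le_one_iff.2 (by nlinarith)
  have hxe : δ * x * e ≤ 1 := by
    have h1 : e * Real.exp (δ * x) = 1 := by rw [he, ← Real.exp_add]; simp
    nlinarith [Real.add_one_le_exp (δ * x)]
  have hxe' : x * e ≤ 1 / δ := by rw [le_div_iff₀ hδ]; linarith
  calc e ^ 2 * y ≤ e ^ 2 * (C + η * x) := by gcongr
    _ = (C * e + η * (x * e)) * e := by ring
    _ ≤ (C * 1 + η * (1 / δ)) * e := by gcongr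
    _ = _ := by ring

lemma tendsto_integral_one_sub_exp_sq_mul {h : ℝ → ℝ} (hh : IntegrableOn h (Ioi 0)) :
    Filter.Tendsto (fun δ : ℝ => ∫ x in Ioi (0 : ℝ), (1 - Real.exp (-δ * x)) ^ 2 * h x)
      (nhdsWithin 0 (Ioi 0)) (nhds 0) := by
  have hlim := tendsto_integral_filter_of_dominated_convergence
    (μ := volume.restrict (Ioi (0 : ℝ))) (l := nhdsWithin (0 : ℝ) (Ioi 0))
    (F := fun δ x => (1 - Real.exp (-δ * x)) ^ 2 * h x) (f := fun _ => (0 : ℝ))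
    (fun x => ‖h x‖) ?_ ?_ hh.norm ?_
  · simpa using hlim
  · exact .of_forall fun δ =>
      (by fun_prop : Continuous fun x : ℝ => (1 - Real.exp (-δ * x)) ^ 2).aestronglyMeasurable.mul
        hh.aestronglyMeasurable
  · filter_upwards [self_mem_nhdsWithin] with δ hδ
    filter_upwards [ae_restrict_mem measurableSet_Ioi] with x hx
    have he1 : Real.exp (-δ * x) ≤ 1 :=
      Real.exp_le_one_iff.2 (by nlinarith [mul_pos (mem_Ioi.1 hδ) (mem_Ioi.1 hx)])
    have he0 := Real.exp_pos (-δ * x)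
    rw [norm_mul, Real.norm_of_nonneg (sq_nonneg _)]
    exact mul_le_of_le_one_left (norm_nonneg _) (pow_le_one₀ (by linarith) (by linarith))
  · refine .of_forall fun x => ?_
    have hcont : Continuous fun δ : ℝ => (1 - Real.exp (-δ * x)) ^ 2 * h x := by fun_prop
    simpa using (hcont.tendsto 0).mono_left nhdsWithin_le_nhds

/-- density of `H¹(ℛ)` in the homogeneous space `Ḣ¹(ℛ)` on the tadpole graph
(half-line `[0,∞)` and loop `[0,L]` joined at the vertex), for the seminorm
`‖f‖² = ‖f₁'‖²_{L²(0,∞)} + ‖f₂'‖²_{L²(0,L)}`. -/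
theorem stmt_0 (L : ℝ) (hL : 0 < L)
    (f₁ f₁' f₂ f₂' : ℝ → ℂ)
    -- f₁ is (locally) absolutely continuous on [0,∞) with derivative f₁' ∈ L²(0,∞)
    (hf₁ : ∀ x ∈ Ici (0 : ℝ), HasDerivWithinAt f₁ (f₁' x) (Ici 0) x)
    (hf₁' : IntegrableOn (fun x => ‖f₁' x‖ ^ 2) (Ioi 0))
    -- f₂ ∈ H¹(0,L)
    (hf₂ : ∀ x ∈ Icc (0 : ℝ) L, HasDerivWithinAt f₂ (f₂' x) (Icc 0 L) x)
    (hf₂L2 : IntegrableOn (fun x => ‖f₂ x‖ ^ 2) (Ioo 0 L))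
    (hf₂'L2 : IntegrableOn (fun x => ‖f₂' x‖ ^ 2) (Ioo 0 L))
    -- continuity at the vertex
    (hc₁ : f₁ 0 = f₂ 0) (hc₂ : f₂ 0 = f₂ L) :
    ∀ ε > (0 : ℝ), ∃ g₁ g₁' g₂ g₂' : ℝ → ℂ,
      (∀ x ∈ Ici (0 : ℝ), HasDerivWithinAt g₁ (g₁' x) (Ici 0) x) ∧
      IntegrableOn (fun x => ‖g₁ x‖ ^ 2) (Ioi 0) ∧
      IntegrableOn (fun x => ‖g₁' x‖ ^ 2) (Ioi 0) ∧
      (∀ x ∈ Icc (0 : ℝ) L, HasDerivWithinAt g₂ (g₂' x) (Icc 0 L) x) ∧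
      IntegrableOn (fun x => ‖g₂ x‖ ^ 2) (Ioo 0 L) ∧
      IntegrableOn (fun x => ‖g₂' x‖ ^ 2) (Ioo 0 L) ∧
      g₁ 0 = g₂ 0 ∧ g₂ 0 = g₂ L ∧
      (∫ x in Ioi (0 : ℝ), ‖f₁' x - g₁' x‖ ^ 2)
        + (∫ x in Ioo (0 : ℝ) L, ‖f₂' x - g₂' x‖ ^ 2) ≤ ε ^ 2 := by
  intro ε hε
  have hd : ∀ x ∈ Ioi (0 : ℝ), HasDerivAt f₁ (f₁' x) x := fun x hx =>
    (hf₁ x (Ioi_subset_Ici_self hx)).hasDerivAt (Ici_mem_nhds hx)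
  have hcont : ContinuousOn f₁ (Ici 0) := fun x hx => (hf₁ x hx).continuousWithinAt
  have hη : 0 < ε ^ 2 / 8 := by positivity
  obtain ⟨C, hC, hbound⟩ := exists_norm_sq_le_add_mul hcont hd hf₁' hη
  obtain ⟨δ, ⟨hI, hδC⟩, hδ : 0 < δ⟩ :
      ∃ δ, ((∫ x in Ioi (0 : ℝ), (1 - Real.exp (-δ * x)) ^ 2 * ‖f₁' x‖ ^ 2) < ε ^ 2 / 8 ∧
        δ * C < ε ^ 2 / 8) ∧ δ ∈ Ioi (0 : ℝ) := by
    have hlin : Filter.Tendsto (fun δ : ℝ => δ * C) (nhdsWithin 0 (Ioi 0)) (nhds 0) := by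
      simpa using ((continuous_mul_const C).tendsto 0).mono_left nhdsWithin_le_nhds
    exact ((((tendsto_integral_one_sub_exp_sq_mul hf₁').eventually (gt_mem_nhds hη)).and
      (hlin.eventually (gt_mem_nhds hη))).and self_mem_nhdsWithin).exists
  set η := ε ^ 2 / 8 with hηdef
  have hexp : IntegrableOn (fun x => Real.exp (-δ * x)) (Ioi 0) := exp_neg_integrableOn_Ioi 0 hδ
  have hexpval : ∫ x in Ioi (0 : ℝ), Real.exp (-δ * x) = 1 / δ := by
    have := integral_exp_mul_Ioi (a := -δ) (by linarith) 0
    simpa using this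
  have hfm : AEStronglyMeasurable f₁ (volume.restrict (Ioi 0)) :=
    (hcont.mono Ioi_subset_Ici_self).aestronglyMeasurable measurableSet_Ioi
  have hf'm := aestronglyMeasurable_of_hasDerivAt_Ioi hd
  have hem : Continuous fun x : ℝ => ((Real.exp (-δ * x) : ℝ) : ℂ) := by fun_prop
  have hmaj : IntegrableOn (fun x => (C + η / δ) * Real.exp (-δ * x)) (Ioi 0) :=
    hexp.const_mul _
  have hgsq : ∀ x ∈ Ioi (0 : ℝ), Real.exp (-δ * x) ^ 2 * ‖f₁ x‖ ^ 2
      ≤ (C + η / δ) * Real.exp (-δ * x) := fun x hx =>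
    mul_exp_neg_sq_le hC hη.le hδ (le_of_lt hx) (hbound x (le_of_lt hx))
  let g : ℝ → ℂ := fun x => (Real.exp (-δ * x) : ℝ) * f₁ x
  let g' : ℝ → ℂ := fun x => (Real.exp (-δ * x) : ℝ) * f₁' x
    - δ * ((Real.exp (-δ * x) : ℝ) * f₁ x)
  have hgm : AEStronglyMeasurable g (volume.restrict (Ioi 0)) :=
    hem.aestronglyMeasurable.mul hfm
  have hg'm : AEStronglyMeasurable g' (volume.restrict (Ioi 0)) :=
    (hem.aestronglyMeasurable.mul hf'm).sub (hgm.const_mul _)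
  have hsq (x : ℝ) : ‖g x‖ ^ 2 = Real.exp (-δ * x) ^ 2 * ‖f₁ x‖ ^ 2 := by
    simp only [g, norm_mul, Complex.norm_real, Real.norm_eq_abs, Real.abs_exp, mul_pow]
  have hgint : IntegrableOn (fun x => ‖g x‖ ^ 2) (Ioi 0) := by
    refine hmaj.mono' (hgm.norm.pow 2) ?_
    filter_upwards [ae_restrict_mem measurableSet_Ioi] with x hx
    rw [Real.norm_of_nonneg (by positivity), hsq]
    exact hgsq x hx
  have hdiff : ∀ x ∈ Ioi (0 : ℝ), ‖f₁' x - g' x‖ ^ 2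
      ≤ 2 * ((1 - Real.exp (-δ * x)) ^ 2 * ‖f₁' x‖ ^ 2)
        + 2 * δ ^ 2 * ((C + η / δ) * Real.exp (-δ * x)) := by
    intro x hx
    have heq : f₁' x - g' x = ((1 - Real.exp (-δ * x) : ℝ) : ℂ) * f₁' x + (δ : ℂ) * g x := by
      simp only [g, g']; push_cast; ring
    have htri : ‖f₁' x - g' x‖
        ≤ ‖((1 - Real.exp (-δ * x) : ℝ) : ℂ) * f₁' x‖ + ‖(δ : ℂ) * g x‖ :=
      heq ▸ norm_add_le _ _
    have hfirst : ‖((1 - Real.exp (-δ * x) : ℝ) : ℂ) * f₁' x‖ ^ 2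
        = (1 - Real.exp (-δ * x)) ^ 2 * ‖f₁' x‖ ^ 2 := by
      rw [norm_mul, mul_pow, Complex.norm_real, Real.norm_eq_abs, sq_abs]
    have hsecond : ‖(δ : ℂ) * g x‖ ^ 2 ≤ δ ^ 2 * ((C + η / δ) * Real.exp (-δ * x)) := by
      rw [norm_mul, mul_pow, Complex.norm_real, Real.norm_eq_abs, sq_abs, hsq]
      exact mul_le_mul_of_nonneg_left (hgsq x hx) (sq_nonneg δ)
    have hpow := pow_le_pow_left₀ (norm_nonneg _) htri 2
    linarith [add_sq_le (a := ‖((1 - Real.exp (-δ * x) : ℝ) : ℂ) * f₁' x‖) (b := ‖(δ : ℂ) * g x‖)]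
  have hcut : IntegrableOn (fun x => (1 - Real.exp (-δ * x)) ^ 2 * ‖f₁' x‖ ^ 2) (Ioi 0) := by
    refine hf₁'.mono' ((by fun_prop : Continuous fun x : ℝ =>
      (1 - Real.exp (-δ * x)) ^ 2).aestronglyMeasurable.mul hf₁'.aestronglyMeasurable) ?_
    filter_upwards [ae_restrict_mem measurableSet_Ioi] with x hx
    have he1 : Real.exp (-δ * x) ≤ 1 :=
      Real.exp_le_one_iff.2 (by nlinarith [mul_pos hδ (mem_Ioi.1 hx)])
    have he0 := Real.exp_pos (-δ * x)
    rw [Real.norm_of_nonneg (by positivity)]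
    exact mul_le_of_le_one_left (by positivity) (pow_le_one₀ (by linarith) (by linarith))
  have hmajor : IntegrableOn (fun x => 2 * ((1 - Real.exp (-δ * x)) ^ 2 * ‖f₁' x‖ ^ 2)
        + 2 * δ ^ 2 * ((C + η / δ) * Real.exp (-δ * x))) (Ioi 0) :=
    (hcut.const_mul 2).add (hmaj.const_mul _)
  have hdint : IntegrableOn (fun x => ‖f₁' x - g' x‖ ^ 2) (Ioi 0) := by
    refine hmajor.mono' ((hf'm.sub hg'm).norm.pow 2) ?_
    filter_upwards [ae_restrict_mem measurableSet_Ioi] with x hx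
    rw [Real.norm_of_nonneg (by positivity)]
    exact hdiff x hx
  have hg'int : IntegrableOn (fun x => ‖g' x‖ ^ 2) (Ioi 0) := by
    refine ((hf₁'.const_mul 2).add (hdint.const_mul 2)).mono' (hg'm.norm.pow 2)
      (.of_forall fun x => ?_)
    rw [Real.norm_of_nonneg (by positivity)]
    have htri : ‖g' x‖ ≤ ‖f₁' x‖ + ‖f₁' x - g' x‖ := by
      simpa using norm_sub_le (f₁' x) (f₁' x - g' x)
    have hpow := pow_le_pow_left₀ (norm_nonneg _) htri 2
    simp only [Pi.add_apply]
    linarith [add_sq_le (a := ‖f₁' x‖) (b := ‖f₁' x - g' x‖)]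
  refine ⟨g, g', f₂, f₂', fun x hx => ?_, hgint, hg'int, hf₂, hf₂L2, hf₂'L2, ?_, hc₂, ?_⟩
  · have hlin : HasDerivAt (fun y : ℝ => -δ * y) (-δ) x := by
      simpa using (hasDerivAt_id x).const_mul (-δ)
    refine ((hlin.exp.ofReal_comp.hasDerivWithinAt).mul (hf₁ x hx)).congr_deriv ?_
    simp only [g']
    push_cast
    ring
  · simpa [g] using hc₁
  · have hle := setIntegral_mono_on hdint hmajor measurableSet_Ioi hdiff
    rw [integral_add (hcut.const_mul 2) (hmaj.const_mul _), integral_const_mul,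
      integral_const_mul, integral_const_mul, hexpval] at hle
    have hval : 2 * δ ^ 2 * ((C + η / δ) * (1 / δ)) = 2 * (δ * C) + 2 * η := by
      field_simp
    simp only [sub_self, norm_zero, ne_eq, OfNat.ofNat_ne_zero, not_false_eq_true, zero_pow,
      integral_zero, add_zero]
    linarith
end

section
/- Let α ∈ ℝ and L > 0. Let u = (u₁,u₂) and v = (v₁,v₂) be functions on the tadpole graph with u₁ locally absolutely continuous, u₁', u₁'' ∈ L²(0,∞), u₂ ∈ H²(0,L), v₁ ∈ H¹(0,∞), v₂ ∈ H¹(0,L), satisfying the continuity conditions u₁(0) = u₂(0) = u₂(L) and v₁(0) = v₂(0) = v₂(L), and the damped transmission condition u₁'(0) + u₂'(0) − u₂'(L) = α·v₁(0). Then ⟨v₁',u₁'⟩_{L²(0,∞)} + ⟨v₂',u₂'⟩_{L²(0,L)} + ⟨u₁'',v₁⟩_{L²(0,∞)} + ⟨u₂'',v₂⟩_{L²(0,L)} = −2i·Im(⟨u₁',v₁'⟩_{L²(0,∞)} + ⟨u₂',v₂'⟩_{L²(0,L)}) − α·|v₁(0)|². -/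
open MeasureTheory Set ComplexConjugate

/-- A function with an everywhere-defined derivative on an open set has measurable derivative. -/
lemma aestronglyMeasurable_of_hasDerivAt {f f' : ℝ → ℂ} {s : Set ℝ} (hs : IsOpen s)
    (hf : ∀ x ∈ s, HasDerivAt f (f' x) x) :
    AEStronglyMeasurable f' (volume.restrict s) :=
  (stronglyMeasurable_deriv f).aestronglyMeasurable.congr <|
    (ae_restrict_iff' hs.measurableSet).2 <| .of_forall fun x hx => (hf x hx).deriv

lemma integrableOn_mul_conj {f g : ℝ → ℂ} {s : Set ℝ}
    (hfm : AEStronglyMeasurable f (volume.restrict s))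
    (hgm : AEStronglyMeasurable g (volume.restrict s))
    (hf : IntegrableOn (fun x => ‖f x‖ ^ 2) s) (hg : IntegrableOn (fun x => ‖g x‖ ^ 2) s) :
    IntegrableOn (fun x => f x * conj (g x)) s :=
  MemLp.integrable_mul (p := 2) (q := 2) ((memLp_two_iff_integrable_sq_norm hfm).2 hf)
    ((memLp_two_iff_integrable_sq_norm hgm).2 hg).star

lemma hasDerivAt_mul_conj {f g : ℝ → ℂ} {f' g' : ℂ} {x : ℝ}
    (hf : HasDerivAt f f' x) (hg : HasDerivAt g g' x) :
    HasDerivAt (fun x => f x * conj (g x)) (f' * conj (g x) + f x * conj g') x :=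
  hf.mul hg.star

/-- Integration by parts on a half-line for `L²` functions with `L²` derivatives. -/
lemma integral_Ioi_mul_conj_by_parts {f f' g g' : ℝ → ℂ} {a : ℝ}
    (hf : ∀ x ∈ Ici a, HasDerivWithinAt f (f' x) (Ici a) x)
    (hg : ∀ x ∈ Ici a, HasDerivWithinAt g (g' x) (Ici a) x)
    (hf2 : IntegrableOn (fun x => ‖f x‖ ^ 2) (Ioi a))
    (hf'2 : IntegrableOn (fun x => ‖f' x‖ ^ 2) (Ioi a))
    (hg2 : IntegrableOn (fun x => ‖g x‖ ^ 2) (Ioi a))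
    (hg'2 : IntegrableOn (fun x => ‖g' x‖ ^ 2) (Ioi a)) :
    (∫ x in Ioi a, f' x * conj (g x)) + (∫ x in Ioi a, f x * conj (g' x))
      = -(f a * conj (g a)) := by
  have hfd : ∀ x ∈ Ioi a, HasDerivAt f (f' x) x := fun x hx =>
    (hf x (Ioi_subset_Ici_self hx)).hasDerivAt (Ici_mem_nhds hx)
  have hgd : ∀ x ∈ Ioi a, HasDerivAt g (g' x) x := fun x hx =>
    (hg x (Ioi_subset_Ici_self hx)).hasDerivAt (Ici_mem_nhds hx)
  have hfc : ContinuousOn f (Ici a) := fun x hx => (hf x hx).continuousWithinAt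
  have hgc : ContinuousOn g (Ici a) := fun x hx => (hg x hx).continuousWithinAt
  have hfm := (hfc.mono Ioi_subset_Ici_self).aestronglyMeasurable (μ := volume) measurableSet_Ioi
  have hgm := (hgc.mono Ioi_subset_Ici_self).aestronglyMeasurable (μ := volume) measurableSet_Ioi
  have hf'm := aestronglyMeasurable_of_hasDerivAt isOpen_Ioi hfd
  have hg'm := aestronglyMeasurable_of_hasDerivAt isOpen_Ioi hgd
  have h₁ := integrableOn_mul_conj hf'm hgm hf'2 hg2
  have h₂ := integrableOn_mul_conj hfm hg'm hf2 hg'2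
  have hd := fun x hx => hasDerivAt_mul_conj (hfd x hx) (hgd x hx)
  have hlim := tendsto_zero_of_hasDerivAt_of_integrableOn_Ioi hd (h₁.add h₂)
    (integrableOn_mul_conj hfm hgm hf2 hg2)
  rw [← integral_add h₁ h₂, integral_Ioi_of_hasDerivAt_of_tendsto
    ((hfc.mul hgc.star) a self_mem_Ici) hd (h₁.add h₂) hlim, zero_sub]
  rfl

/-- Integration by parts on a bounded interval for functions with `L²` derivatives. -/
lemma integral_Ioo_mul_conj_by_parts {f f' g g' : ℝ → ℂ} {a b : ℝ} (hab : a ≤ b)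
    (hf : ∀ x ∈ Icc a b, HasDerivWithinAt f (f' x) (Icc a b) x)
    (hg : ∀ x ∈ Icc a b, HasDerivWithinAt g (g' x) (Icc a b) x)
    (hf2 : IntegrableOn (fun x => ‖f x‖ ^ 2) (Ioo a b))
    (hf'2 : IntegrableOn (fun x => ‖f' x‖ ^ 2) (Ioo a b))
    (hg2 : IntegrableOn (fun x => ‖g x‖ ^ 2) (Ioo a b))
    (hg'2 : IntegrableOn (fun x => ‖g' x‖ ^ 2) (Ioo a b)) :
    (∫ x in Ioo a b, f' x * conj (g x)) + (∫ x in Ioo a b, f x * conj (g' x))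
      = f b * conj (g b) - f a * conj (g a) := by
  have hfd : ∀ x ∈ Ioo a b, HasDerivAt f (f' x) x := fun x hx =>
    (hf x (Ioo_subset_Icc_self hx)).hasDerivAt (Icc_mem_nhds hx.1 hx.2)
  have hgd : ∀ x ∈ Ioo a b, HasDerivAt g (g' x) x := fun x hx =>
    (hg x (Ioo_subset_Icc_self hx)).hasDerivAt (Icc_mem_nhds hx.1 hx.2)
  have hfc : ContinuousOn f (Icc a b) := fun x hx => (hf x hx).continuousWithinAt
  have hgc : ContinuousOn g (Icc a b) := fun x hx => (hg x hx).continuousWithinAt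
  have hfm := (hfc.mono Ioo_subset_Icc_self).aestronglyMeasurable (μ := volume) measurableSet_Ioo
  have hgm := (hgc.mono Ioo_subset_Icc_self).aestronglyMeasurable (μ := volume) measurableSet_Ioo
  have hf'm := aestronglyMeasurable_of_hasDerivAt isOpen_Ioo hfd
  have hg'm := aestronglyMeasurable_of_hasDerivAt isOpen_Ioo hgd
  have h₁ := integrableOn_mul_conj hf'm hgm hf'2 hg2
  have h₂ := integrableOn_mul_conj hfm hg'm hf2 hg'2
  have hd := fun x hx => hasDerivAt_mul_conj (hfd x hx) (hgd x hx)
  rw [← integral_add h₁ h₂, ← integral_Ioc_eq_integral_Ioo,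
    ← intervalIntegral.integral_of_le hab]
  exact intervalIntegral.integral_eq_sub_of_hasDerivAt_of_le hab (hfc.mul hgc.star) hd
    ((intervalIntegrable_iff_integrableOn_Ioo_of_le hab).2 (h₁.add h₂))

lemma integral_mul_conj_symm (f g : ℝ → ℂ) (s : Set ℝ) :
    (∫ x in s, f x * conj (g x)) = conj (∫ x in s, g x * conj (f x)) := by
  rw [← integral_conj]
  simp [mul_comm]

/-- the dissipation identity
`⟨v₁',u₁'⟩ + ⟨v₂',u₂'⟩ + ⟨u₁'',v₁⟩ + ⟨u₂'',v₂⟩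
  = −2i·Im(⟨u₁',v₁'⟩ + ⟨u₂',v₂'⟩) − α·|v₁(0)|²`
for `(u,v)` in the domain of the damped wave operator `𝒜_α` on the tadpole graph. -/
theorem stmt_1 (α L : ℝ) (hL : 0 < L)
    (u₁ u₁' u₁'' u₂ u₂' u₂'' v₁ v₁' v₂ v₂' : ℝ → ℂ)
    -- u₁ locally absolutely continuous with u₁', u₁'' ∈ L²(0,∞)
    (hu₁ : ∀ x ∈ Ici (0 : ℝ), HasDerivWithinAt u₁ (u₁' x) (Ici 0) x)
    (hu₁d : ∀ x ∈ Ici (0 : ℝ), HasDerivWithinAt u₁' (u₁'' x) (Ici 0) x)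
    (hu₁'L2 : IntegrableOn (fun x => ‖u₁' x‖ ^ 2) (Ioi 0))
    (hu₁''L2 : IntegrableOn (fun x => ‖u₁'' x‖ ^ 2) (Ioi 0))
    -- u₂ ∈ H²(0,L)
    (hu₂ : ∀ x ∈ Icc (0 : ℝ) L, HasDerivWithinAt u₂ (u₂' x) (Icc 0 L) x)
    (hu₂d : ∀ x ∈ Icc (0 : ℝ) L, HasDerivWithinAt u₂' (u₂'' x) (Icc 0 L) x)
    (hu₂L2 : IntegrableOn (fun x => ‖u₂ x‖ ^ 2) (Ioo 0 L))
    (hu₂'L2 : IntegrableOn (fun x => ‖u₂' x‖ ^ 2) (Ioo 0 L))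
    (hu₂''L2 : IntegrableOn (fun x => ‖u₂'' x‖ ^ 2) (Ioo 0 L))
    -- v₁ ∈ H¹(0,∞)
    (hv₁ : ∀ x ∈ Ici (0 : ℝ), HasDerivWithinAt v₁ (v₁' x) (Ici 0) x)
    (hv₁L2 : IntegrableOn (fun x => ‖v₁ x‖ ^ 2) (Ioi 0))
    (hv₁'L2 : IntegrableOn (fun x => ‖v₁' x‖ ^ 2) (Ioi 0))
    -- v₂ ∈ H¹(0,L)
    (hv₂ : ∀ x ∈ Icc (0 : ℝ) L, HasDerivWithinAt v₂ (v₂' x) (Icc 0 L) x)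
    (hv₂L2 : IntegrableOn (fun x => ‖v₂ x‖ ^ 2) (Ioo 0 L))
    (hv₂'L2 : IntegrableOn (fun x => ‖v₂' x‖ ^ 2) (Ioo 0 L))
    -- continuity at the vertex
    (hcu : u₁ 0 = u₂ 0 ∧ u₂ 0 = u₂ L)
    (hcv : v₁ 0 = v₂ 0 ∧ v₂ 0 = v₂ L)
    -- damped transmission condition
    (htr : u₁' 0 + u₂' 0 - u₂' L = (α : ℂ) * v₁ 0) :
    (∫ x in Ioi (0 : ℝ), v₁' x * conj (u₁' x))
      + (∫ x in Ioo (0 : ℝ) L, v₂' x * conj (u₂' x))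
      + (∫ x in Ioi (0 : ℝ), u₁'' x * conj (v₁ x))
      + (∫ x in Ioo (0 : ℝ) L, u₂'' x * conj (v₂ x))
    = -2 * Complex.I *
        ((((∫ x in Ioi (0 : ℝ), u₁' x * conj (v₁' x))
            + ∫ x in Ioo (0 : ℝ) L, u₂' x * conj (v₂' x)).im : ℝ) : ℂ)
      - (α : ℂ) * ((‖v₁ 0‖ ^ 2 : ℝ) : ℂ) := by
  have h₁ := integral_Ioi_mul_conj_by_parts hu₁d hv₁ hu₁'L2 hu₁''L2 hv₁L2 hv₁'L2
  have h₂ := integral_Ioo_mul_conj_by_parts hL.le hu₂d hv₂ hu₂'L2 hu₂''L2 hv₂L2 hv₂'L2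
  rw [← hcv.2, ← hcv.1] at h₂
  rw [integral_mul_conj_symm v₁' u₁', integral_mul_conj_symm v₂' u₂']
  set A := ∫ x in Ioi (0 : ℝ), u₁' x * conj (v₁' x)
  set B := ∫ x in Ioo (0 : ℝ) L, u₂' x * conj (v₂' x)
  have him := Complex.sub_conj (A + B)
  have hnorm := Complex.mul_conj' (v₁ 0)
  rw [map_add] at him
  push_cast at him ⊢
  linear_combination h₁ + h₂ - him - conj (v₁ 0) * htr - α * hnorm
end

section
/- Let α ≥ 0, L > 0, and z ∈ ℂ with Re z > 0. Let u = (u₁,u₂), v = (v₁,v₂) be functions on the tadpole graph with u₁ locally absolutely continuous, u₁', u₁'' ∈ L²(0,∞), u₂ ∈ H²(0,L), v₁ ∈ H¹(0,∞), v₂ ∈ H¹(0,L), satisfying u₁(0)=u₂(0)=u₂(L), v₁(0)=v₂(0)=v₂(L), and u₁'(0)+u₂'(0)−u₂'(L) = α·v₁(0). Set N² = ‖u₁'‖²_{L²(0,∞)} + ‖u₂'‖²_{L²(0,L)} + ‖v₁‖²_{L²(0,∞)} + ‖v₂‖²_{L²(0,L)} and M² = ‖v₁' − z·u₁'‖²_{L²(0,∞)}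 + ‖v₂' − z·u₂'‖²_{L²(0,L)} + ‖u₁'' − z·v₁‖²_{L²(0,∞)} + ‖u₂'' − z·v₂‖²_{L²(0,L)}. Then M·N ≥ (Re z)·N². (This is the estimate ‖(𝒜_α − z)U‖_ℋ·‖U‖_ℋ ≥ Re z·‖U‖²_ℋ giving the resolvent bound ‖(𝒜_α − z)^{-1}‖ ≤ 1/Re z on the right half-plane.) -/
open MeasureTheory Set

section EnergyIdentity

variable {s : Set ℝ} {p p' q q' : ℝ → ℂ}

/-- A function that is square integrable on an open set, where it is a derivative, is in `L²`. -/
lemma memLp_two_of_hasDerivAt {f f' : ℝ → ℂ} (hs : IsOpen s)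
    (hf : ∀ x ∈ s, HasDerivAt f (f' x) x) (hf' : IntegrableOn (fun x => ‖f' x‖ ^ 2) s) :
    MemLp f' 2 (volume.restrict s) := by
  have hm : AEStronglyMeasurable f' (volume.restrict s) :=
    (aestronglyMeasurable_deriv f _).congr <|
      (ae_restrict_iff' hs.measurableSet).2 <| .of_forall fun x hx => (hf x hx).deriv
  exact (memLp_two_iff_integrable_sq_norm hm).2 hf'

/-- A differentiable function that is square integrable on an open set is in `L²`. -/
lemma memLp_two_of_differentiable {f f' : ℝ → ℂ} (hs : IsOpen s)
    (hf : ∀ x ∈ s, HasDerivAt f (f' x) x) (hf₂ : IntegrableOn (fun x => ‖f x‖ ^ 2) s) :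
    MemLp f 2 (volume.restrict s) := by
  have hc : ContinuousOn f s := fun x hx => (hf x hx).continuousAt.continuousWithinAt
  exact (memLp_two_iff_integrable_sq_norm (hc.aestronglyMeasurable hs.measurableSet)).2 hf₂

/-- Integrability of the real inner product of two `L²` functions. -/
lemma integrable_real_inner {f g : ℝ → ℂ} {μ : Measure ℝ} (hf : MemLp f 2 μ) (hg : MemLp g 2 μ) :
    Integrable (fun x => inner ℝ (f x) (g x)) μ := by
  refine ((hf.integrable_norm_pow two_ne_zero).add (hg.integrable_norm_pow two_ne_zero)).mono'
    (hf.1.inner hg.1) (.of_forall fun x => ?_)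
  have h := norm_inner_le_norm (𝕜 := ℝ) (f x) (g x)
  simp only [Pi.add_apply]
  nlinarith [sq_nonneg (‖f x‖ - ‖g x‖), sq_nonneg ‖f x‖, sq_nonneg ‖g x‖]

/-- Pointwise form of the resolvent estimate, from `‖a - i (Im z) b‖² ≥ 0`. -/
lemma re_sq_mul_norm_sq_sub_inner_le (z a b : ℂ) :
    z.re ^ 2 * ‖b‖ ^ 2 - 2 * z.re * inner ℝ b a ≤ ‖a - z * b‖ ^ 2 := by
  simp only [Complex.sq_norm, Complex.normSq_apply, Complex.inner, Complex.sub_re, Complex.sub_im,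
    Complex.mul_re, Complex.mul_im, Complex.conj_re, Complex.conj_im]
  nlinarith [sq_nonneg (a.re + z.im * b.im), sq_nonneg (a.im - z.im * b.re)]

/-- The integrated resolvent estimate, before the boundary terms are evaluated. -/
lemma re_sq_mul_integral_sub_le {μ : Measure ℝ} (z : ℂ) (hp : MemLp p 2 μ) (hp' : MemLp p' 2 μ)
    (hq : MemLp q 2 μ) (hq' : MemLp q' 2 μ) :
    z.re ^ 2 * ((∫ x, ‖p x‖ ^ 2 ∂μ) + ∫ x, ‖q x‖ ^ 2 ∂μ)
        - 2 * z.re * ∫ x, (inner ℝ (p x) (q' x) + inner ℝ (p' x) (q x)) ∂μ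
      ≤ (∫ x, ‖q' x - z * p x‖ ^ 2 ∂μ) + ∫ x, ‖p' x - z * q x‖ ^ 2 ∂μ := by
  have key : ∀ {a b : ℝ → ℂ}, MemLp a 2 μ → MemLp b 2 μ →
      z.re ^ 2 * (∫ x, ‖b x‖ ^ 2 ∂μ) - 2 * z.re * ∫ x, inner ℝ (b x) (a x) ∂μ
        ≤ ∫ x, ‖a x - z * b x‖ ^ 2 ∂μ := by
    intro a b ha hb
    have h₁ := (hb.integrable_norm_pow two_ne_zero).const_mul (z.re ^ 2)
    have h₂ := (integrable_real_inner hb ha).const_mul (2 * z.re)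
    rw [← integral_const_mul, ← integral_const_mul, ← integral_sub h₁ h₂]
    exact integral_mono (h₁.sub h₂) ((ha.sub (hb.const_mul z)).integrable_norm_pow two_ne_zero)
      fun x => re_sq_mul_norm_sq_sub_inner_le z (a x) (b x)
  have hpq : ∫ x, inner ℝ (p' x) (q x) ∂μ = ∫ x, inner ℝ (q x) (p' x) ∂μ :=
    integral_congr_ae (.of_forall fun x => real_inner_comm _ _)
  rw [integral_add (integrable_real_inner hp hq') (integrable_real_inner hp' hq), hpq]
  linarith [key hq' hp, key hp' hq]

/-- The resolvent estimate on a half-line, with its boundary term. -/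
lemma re_sq_mul_integral_add_inner_le_Ioi {a : ℝ} (z : ℂ)
    (hp : ∀ x ∈ Ici a, HasDerivWithinAt p (p' x) (Ici a) x)
    (hq : ∀ x ∈ Ici a, HasDerivWithinAt q (q' x) (Ici a) x)
    (hp₂ : IntegrableOn (fun x => ‖p x‖ ^ 2) (Ioi a))
    (hp'₂ : IntegrableOn (fun x => ‖p' x‖ ^ 2) (Ioi a))
    (hq₂ : IntegrableOn (fun x => ‖q x‖ ^ 2) (Ioi a))
    (hq'₂ : IntegrableOn (fun x => ‖q' x‖ ^ 2) (Ioi a)) :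
    z.re ^ 2 * ((∫ x in Ioi a, ‖p x‖ ^ 2) + ∫ x in Ioi a, ‖q x‖ ^ 2)
        + 2 * z.re * inner ℝ (p a) (q a)
      ≤ (∫ x in Ioi a, ‖q' x - z * p x‖ ^ 2) + ∫ x in Ioi a, ‖p' x - z * q x‖ ^ 2 := by
  have dp : ∀ x ∈ Ioi a, HasDerivAt p (p' x) x := fun x hx =>
    (hp x (Ioi_subset_Ici_self hx)).hasDerivAt (Ici_mem_nhds hx)
  have dq : ∀ x ∈ Ioi a, HasDerivAt q (q' x) x := fun x hx =>
    (hq x (Ioi_subset_Ici_self hx)).hasDerivAt (Ici_mem_nhds hx)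
  have mp := memLp_two_of_differentiable isOpen_Ioi dp hp₂
  have mp' := memLp_two_of_hasDerivAt isOpen_Ioi dp hp'₂
  have mq := memLp_two_of_differentiable isOpen_Ioi dq hq₂
  have mq' := memLp_two_of_hasDerivAt isOpen_Ioi dq hq'₂
  have dpq : ∀ x ∈ Ioi a, HasDerivAt (fun x => inner ℝ (p x) (q x))
      (inner ℝ (p x) (q' x) + inner ℝ (p' x) (q x)) x := fun x hx =>
    (dp x hx).inner ℝ (dq x hx)
  have hint : IntegrableOn (fun x => inner ℝ (p x) (q' x) + inner ℝ (p' x) (q x)) (Ioi a) :=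
    (integrable_real_inner mp mq').add (integrable_real_inner mp' mq)
  have hlim := tendsto_zero_of_hasDerivAt_of_integrableOn_Ioi dpq hint
    (integrable_real_inner mp mq)
  have hcont : ContinuousWithinAt (fun x => inner ℝ (p x) (q x)) (Ici a) a :=
    (hp a self_mem_Ici).continuousWithinAt.inner (hq a self_mem_Ici).continuousWithinAt
  have hftc := integral_Ioi_of_hasDerivAt_of_tendsto hcont dpq hint hlim
  have h := re_sq_mul_integral_sub_le z mp mp' mq mq'
  rw [hftc] at h
  linarith

/-- The resolvent estimate on a bounded interval, with its boundary terms. -/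
lemma re_sq_mul_integral_sub_inner_le_Ioo {a b : ℝ} (hab : a ≤ b) (z : ℂ)
    (hp : ∀ x ∈ Icc a b, HasDerivWithinAt p (p' x) (Icc a b) x)
    (hq : ∀ x ∈ Icc a b, HasDerivWithinAt q (q' x) (Icc a b) x)
    (hp₂ : IntegrableOn (fun x => ‖p x‖ ^ 2) (Ioo a b))
    (hp'₂ : IntegrableOn (fun x => ‖p' x‖ ^ 2) (Ioo a b))
    (hq₂ : IntegrableOn (fun x => ‖q x‖ ^ 2) (Ioo a b))
    (hq'₂ : IntegrableOn (fun x => ‖q' x‖ ^ 2) (Ioo a b)) :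
    z.re ^ 2 * ((∫ x in Ioo a b, ‖p x‖ ^ 2) + ∫ x in Ioo a b, ‖q x‖ ^ 2)
        - 2 * z.re * (inner ℝ (p b) (q b) - inner ℝ (p a) (q a))
      ≤ (∫ x in Ioo a b, ‖q' x - z * p x‖ ^ 2) + ∫ x in Ioo a b, ‖p' x - z * q x‖ ^ 2 := by
  have dp : ∀ x ∈ Ioo a b, HasDerivAt p (p' x) x := fun x hx =>
    (hp x (Ioo_subset_Icc_self hx)).hasDerivAt (Icc_mem_nhds hx.1 hx.2)
  have dq : ∀ x ∈ Ioo a b, HasDerivAt q (q' x) x := fun x hx =>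
    (hq x (Ioo_subset_Icc_self hx)).hasDerivAt (Icc_mem_nhds hx.1 hx.2)
  have mp := memLp_two_of_differentiable isOpen_Ioo dp hp₂
  have mp' := memLp_two_of_hasDerivAt isOpen_Ioo dp hp'₂
  have mq := memLp_two_of_differentiable isOpen_Ioo dq hq₂
  have mq' := memLp_two_of_hasDerivAt isOpen_Ioo dq hq'₂
  have dpq : ∀ x ∈ Ioo a b, HasDerivAt (fun x => inner ℝ (p x) (q x))
      (inner ℝ (p x) (q' x) + inner ℝ (p' x) (q x)) x := fun x hx =>
    (dp x hx).inner ℝ (dq x hx)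
  have hint : IntegrableOn (fun x => inner ℝ (p x) (q' x) + inner ℝ (p' x) (q x)) (Ioo a b) :=
    (integrable_real_inner mp mq').add (integrable_real_inner mp' mq)
  have hcont : ContinuousOn (fun x => inner ℝ (p x) (q x)) (Icc a b) := fun x hx =>
    (hp x hx).continuousWithinAt.inner (hq x hx).continuousWithinAt
  have hftc := intervalIntegral.integral_eq_sub_of_hasDerivAt_of_le hab hcont dpq
    ((intervalIntegrable_iff_integrableOn_Ioo_of_le hab).2 hint)
  rw [intervalIntegral.integral_of_le hab, integral_Ioc_eq_integral_Ioo] at hftc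
  have h := re_sq_mul_integral_sub_le z mp mp' mq mq'
  rwa [hftc] at h

end EnergyIdentity

/-- the estimate `‖(𝒜_α − z)U‖_ℋ · ‖U‖_ℋ ≥ Re z · ‖U‖²_ℋ` for `U = (u,v)` in the
domain of the damped wave operator `𝒜_α` on the tadpole graph and `Re z > 0`, where
`N² = ‖U‖²_ℋ` and `M² = ‖(𝒜_α − z)U‖²_ℋ`. -/
theorem stmt_5 (α L : ℝ) (hα : 0 ≤ α) (hL : 0 < L) (z : ℂ) (hz : 0 < z.re)
    (u₁ u₁' u₁'' u₂ u₂' u₂'' v₁ v₁' v₂ v₂' : ℝ → ℂ)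
    (hu₁ : ∀ x ∈ Ici (0 : ℝ), HasDerivWithinAt u₁ (u₁' x) (Ici 0) x)
    (hu₁d : ∀ x ∈ Ici (0 : ℝ), HasDerivWithinAt u₁' (u₁'' x) (Ici 0) x)
    (hu₁'L2 : IntegrableOn (fun x => ‖u₁' x‖ ^ 2) (Ioi 0))
    (hu₁''L2 : IntegrableOn (fun x => ‖u₁'' x‖ ^ 2) (Ioi 0))
    (hu₂ : ∀ x ∈ Icc (0 : ℝ) L, HasDerivWithinAt u₂ (u₂' x) (Icc 0 L) x)
    (hu₂d : ∀ x ∈ Icc (0 : ℝ) L, HasDerivWithinAt u₂' (u₂'' x) (Icc 0 L) x)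
    (hu₂L2 : IntegrableOn (fun x => ‖u₂ x‖ ^ 2) (Ioo 0 L))
    (hu₂'L2 : IntegrableOn (fun x => ‖u₂' x‖ ^ 2) (Ioo 0 L))
    (hu₂''L2 : IntegrableOn (fun x => ‖u₂'' x‖ ^ 2) (Ioo 0 L))
    (hv₁ : ∀ x ∈ Ici (0 : ℝ), HasDerivWithinAt v₁ (v₁' x) (Ici 0) x)
    (hv₁L2 : IntegrableOn (fun x => ‖v₁ x‖ ^ 2) (Ioi 0))
    (hv₁'L2 : IntegrableOn (fun x => ‖v₁' x‖ ^ 2) (Ioi 0))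
    (hv₂ : ∀ x ∈ Icc (0 : ℝ) L, HasDerivWithinAt v₂ (v₂' x) (Icc 0 L) x)
    (hv₂L2 : IntegrableOn (fun x => ‖v₂ x‖ ^ 2) (Ioo 0 L))
    (hv₂'L2 : IntegrableOn (fun x => ‖v₂' x‖ ^ 2) (Ioo 0 L))
    (hcu : u₁ 0 = u₂ 0 ∧ u₂ 0 = u₂ L)
    (hcv : v₁ 0 = v₂ 0 ∧ v₂ 0 = v₂ L)
    (htr : u₁' 0 + u₂' 0 - u₂' L = (α : ℂ) * v₁ 0) :
    Real.sqrt ((∫ x in Ioi (0 : ℝ), ‖v₁' x - z * u₁' x‖ ^ 2)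
          + (∫ x in Ioo (0 : ℝ) L, ‖v₂' x - z * u₂' x‖ ^ 2)
          + (∫ x in Ioi (0 : ℝ), ‖u₁'' x - z * v₁ x‖ ^ 2)
          + (∫ x in Ioo (0 : ℝ) L, ‖u₂'' x - z * v₂ x‖ ^ 2)) *
      Real.sqrt ((∫ x in Ioi (0 : ℝ), ‖u₁' x‖ ^ 2)
          + (∫ x in Ioo (0 : ℝ) L, ‖u₂' x‖ ^ 2)
          + (∫ x in Ioi (0 : ℝ), ‖v₁ x‖ ^ 2)
          + (∫ x in Ioo (0 : ℝ) L, ‖v₂ x‖ ^ 2))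
    ≥ z.re * ((∫ x in Ioi (0 : ℝ), ‖u₁' x‖ ^ 2)
          + (∫ x in Ioo (0 : ℝ) L, ‖u₂' x‖ ^ 2)
          + (∫ x in Ioi (0 : ℝ), ‖v₁ x‖ ^ 2)
          + (∫ x in Ioo (0 : ℝ) L, ‖v₂ x‖ ^ 2)) := by
  have h₁ := re_sq_mul_integral_add_inner_le_Ioi z hu₁d hv₁ hu₁'L2 hu₁''L2 hv₁L2 hv₁'L2
  have h₂ := re_sq_mul_integral_sub_inner_le_Ioo hL.le z hu₂d hv₂ hu₂'L2 hu₂''L2 hv₂L2 hv₂'L2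
  have hb : inner ℝ (u₁' 0) (v₁ 0) + inner ℝ (u₂' 0) (v₁ 0) - inner ℝ (u₂' L) (v₁ 0)
      = α * ‖v₁ 0‖ ^ 2 := by
    rw [← inner_add_left, ← inner_sub_left, htr, ← Complex.real_smul, real_inner_smul_left,
      real_inner_self_eq_norm_sq]
  rw [← hcv.2, ← hcv.1] at h₂
  have hdiss : 0 ≤ z.re * (α * ‖v₁ 0‖ ^ 2) := by positivity
  rw [← hb] at hdiss
  have hN : 0 ≤ (∫ x in Ioi (0 : ℝ), ‖u₁' x‖ ^ 2) + (∫ x in Ioo (0 : ℝ) L, ‖u₂' x‖ ^ 2)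
      + (∫ x in Ioi (0 : ℝ), ‖v₁ x‖ ^ 2) + (∫ x in Ioo (0 : ℝ) L, ‖v₂ x‖ ^ 2) := by
    positivity
  set N := (∫ x in Ioi (0 : ℝ), ‖u₁' x‖ ^ 2) + (∫ x in Ioo (0 : ℝ) L, ‖u₂' x‖ ^ 2)
      + (∫ x in Ioi (0 : ℝ), ‖v₁ x‖ ^ 2) + (∫ x in Ioo (0 : ℝ) L, ‖v₂ x‖ ^ 2)
  calc z.re * N = z.re * √N * √N := by rw [mul_assoc, Real.mul_self_sqrt hN]
    _ ≤ _ := by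
      refine mul_le_mul_of_nonneg_right (Real.le_sqrt_of_sq_le ?_) (Real.sqrt_nonneg N)
      rw [mul_pow, Real.sq_sqrt hN]
      linarith
end

section
/- Let α ≥ 0 and L > 0. For every z ∈ ℂ with Re z ≥ 0 one has (α + 3)·e^{zL} ≠ 1 − α. Consequently, the only solutions of (e^{zL} − 1)·((α+3)·e^{zL} − (1−α)) = 0 in the closed right half-plane are z = 2πin/L, n ∈ ℤ. -/
/-- For `α ≥ 0`, `L > 0`, one has `(α+3)·e^{zL} ≠ 1−α` for every `z` in the
closed right half-plane, and the only solutions of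
`(e^{zL} − 1)·((α+3)·e^{zL} − (1−α)) = 0` with `Re z ≥ 0` are `z = 2πin/L`, `n ∈ ℤ`. -/
theorem stmt_6 (α L : ℝ) (hα : 0 ≤ α) (hL : 0 < L) :
    (∀ z : ℂ, 0 ≤ z.re → ((α : ℂ) + 3) * Complex.exp (z * L) ≠ 1 - (α : ℂ)) ∧
    {z : ℂ | 0 ≤ z.re ∧
        (Complex.exp (z * L) - 1) * (((α : ℂ) + 3) * Complex.exp (z * L) - (1 - (α : ℂ))) = 0}
      = {z : ℂ | ∃ n : ℤ, z = ((2 * Real.pi * (n : ℝ) / L : ℝ) : ℂ) * Complex.I} := by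
  have hne : ∀ z : ℂ, 0 ≤ z.re →
      ((α : ℂ) + 3) * Complex.exp (z * L) ≠ 1 - (α : ℂ) := by
    intro z hz h
    have hexp : 1 ≤ Real.exp (z.re * L) := Real.one_le_exp (by positivity)
    have hnorm : (α + 3) * Real.exp (z.re * L) = |1 - α| := by
      have h' : ((α + 3 : ℝ) : ℂ) * Complex.exp (z * L) = ((1 - α : ℝ) : ℂ) := by
        push_cast
        exact h
      have hn := congrArg norm h'
      rwa [norm_mul, Complex.norm_exp, Complex.re_mul_ofReal, Complex.norm_real,
        Complex.norm_real, Real.norm_eq_abs, Real.norm_eq_abs,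
        abs_of_nonneg (by linarith : 0 ≤ α + 3)] at hn
    have habs : |1 - α| < α + 3 := abs_lt.mpr ⟨by linarith, by linarith⟩
    nlinarith
  have hL' : (L : ℂ) ≠ 0 := Complex.ofReal_ne_zero.mpr hL.ne'
  refine ⟨hne, Set.ext fun z => ⟨?_, ?_⟩⟩
  · rintro ⟨hz, h⟩
    have h1 : Complex.exp (z * L) = 1 :=
      sub_eq_zero.mp ((mul_eq_zero.mp h).resolve_right (sub_ne_zero.mpr (hne z hz)))
    obtain ⟨n, hn⟩ := Complex.exp_eq_one_iff.mp h1
    refine ⟨n, mul_right_cancel₀ hL' (hn.trans ?_)⟩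
    push_cast
    field_simp
  · rintro ⟨n, rfl⟩
    have h1 : Complex.exp (((2 * Real.pi * (n : ℝ) / L : ℝ) : ℂ) * Complex.I * L) = 1 := by
      refine Complex.exp_eq_one_iff.mpr ⟨n, ?_⟩
      push_cast
      field_simp
    refine ⟨by simp [-Complex.ofReal_div, -Complex.ofReal_mul], ?_⟩
    rw [h1, sub_self, zero_mul]
end

section
/- Let α ∈ ℂ, L > 0 and z ∈ ℂ. Define the 3×3 complex matrix 𝓜_α(z) with rows (1, −1, −1), (1, −e^{zL}, −e^{−zL}), (1−α, 1−e^{zL}, e^{−zL}−1). Then det 𝓜_α(z) = e^{−zL}·(e^{zL} − 1)·((1+α)·e^{zL} − (3−α)). In particular, for real α, det 𝓜_α(z) = 0 if and only if (e^{zL} − 1)·((α+1)·e^{zL} − (3−α)) = 0. -/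
/-- determinant of the matrix `𝓜_α(z)` arising in the eigenvalue problem
for the damped wave operator on the tadpole graph, and its vanishing condition for real `α`. -/
theorem stmt_7 (α : ℂ) (L : ℝ) (hL : 0 < L) (z : ℂ) :
    Matrix.det !![(1 : ℂ), -1, -1;
                  1, -Complex.exp (z * L), -Complex.exp (-(z * L));
                  1 - α, 1 - Complex.exp (z * L), Complex.exp (-(z * L)) - 1]
      = Complex.exp (-(z * L)) * (Complex.exp (z * L) - 1) *
          ((1 + α) * Complex.exp (z * L) - (3 - α)) ∧
    ∀ β : ℝ,
      (Matrix.det !![(1 : ℂ), -1, -1;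
                    1, -Complex.exp (z * L), -Complex.exp (-(z * L));
                    1 - (β : ℂ), 1 - Complex.exp (z * L), Complex.exp (-(z * L)) - 1] = 0
        ↔ (Complex.exp (z * L) - 1) * (((β : ℂ) + 1) * Complex.exp (z * L) - (3 - (β : ℂ))) = 0) := by
  have det_eq (γ : ℂ) :
      Matrix.det !![(1 : ℂ), -1, -1;
                    1, -Complex.exp (z * L), -Complex.exp (-(z * L));
                    1 - γ, 1 - Complex.exp (z * L), Complex.exp (-(z * L)) - 1]
        = Complex.exp (-(z * L)) * (Complex.exp (z * L) - 1) *
            ((1 + γ) * Complex.exp (z * L) - (3 - γ)) := by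
    have hne := Complex.exp_ne_zero (z * L)
    rw [Matrix.det_fin_three, Complex.exp_neg]
    simp
    field_simp
    ring
  refine ⟨det_eq α, fun β => ?_⟩
  rw [det_eq, mul_assoc, mul_eq_zero_iff_left (Complex.exp_ne_zero _), add_comm (1 : ℂ)]
end

section
/- Let L > 0 and α ∈ [0,1] ∪ {3}. Then there is no z ∈ ℂ with Re z < 0 satisfying (e^{zL} − 1)·((α+1)·e^{zL} − (3−α)) = 0. (Hence the damped wave operator 𝒜_α on the tadpole graph has no eigenvalues in the open left half-plane for these values of α.) -/
/-- For `L > 0` and `α ∈ [0,1] ∪ {3}`, the characteristic equation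
`(e^{zL} − 1)·((α+1)·e^{zL} − (3−α)) = 0` has no solution in the open left half-plane. -/
theorem stmt_8 (α L : ℝ) (hL : 0 < L) (hα : α ∈ Set.Icc (0 : ℝ) 1 ∪ {3}) :
    ¬ ∃ z : ℂ, z.re < 0 ∧
      (Complex.exp (z * L) - 1) *
        (((α : ℂ) + 1) * Complex.exp (z * L) - (3 - (α : ℂ))) = 0 := by
  rintro ⟨z, hz, h⟩
  have hlt : ‖Complex.exp (z * L)‖ < 1 := by
    rw [Complex.norm_exp, Real.exp_lt_one_iff, Complex.re_mul_ofReal]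
    exact mul_neg_of_neg_of_pos hz hL
  have hpos : 0 < ‖Complex.exp (z * L)‖ := norm_pos_iff.mpr (Complex.exp_ne_zero _)
  rcases mul_eq_zero.mp h with h | h
  · rw [sub_eq_zero.mp h, norm_one] at hlt
    exact lt_irrefl _ hlt
  · have hnorm : |α + 1| * ‖Complex.exp (z * L)‖ = |3 - α| := by
      have := congrArg norm (sub_eq_zero.mp h)
      rw [norm_mul] at this
      exact_mod_cast this
    rcases hα with ⟨h0, h1⟩ | rfl
    · rw [abs_of_pos (by linarith), abs_of_pos (by linarith)] at hnorm
      nlinarith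
    · norm_num at hnorm
end

section
/- Let L > 0 and α ∈ (1,3). Then { z ∈ ℂ : Re z < 0 and (e^{zL} − 1)·((α+1)·e^{zL} − (3−α)) = 0 } = { (1/L)·ln((3−α)/(1+α)) + (2πn/L)·i : n ∈ ℤ }. -/
/-- For `L > 0` and `α ∈ (1,3)`, the solutions of
`(e^{zL} − 1)·((α+1)·e^{zL} − (3−α)) = 0` in the open left half-plane are exactly
`(1/L)·ln((3−α)/(1+α)) + (2πn/L)i`, `n ∈ ℤ`. -/
theorem stmt_9 (α L : ℝ) (hL : 0 < L) (hα : α ∈ Set.Ioo (1 : ℝ) 3) :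
    {z : ℂ | z.re < 0 ∧
        (Complex.exp (z * L) - 1) *
          (((α : ℂ) + 1) * Complex.exp (z * L) - (3 - (α : ℂ))) = 0}
      = {z : ℂ | ∃ n : ℤ,
          z = ((Real.log ((3 - α) / (1 + α)) / L : ℝ) : ℂ)
              + ((2 * Real.pi * (n : ℝ) / L : ℝ) : ℂ) * Complex.I} := by
  obtain ⟨h1, h3⟩ := hα
  have hr : 0 < (3 - α) / (1 + α) := div_pos (by linarith) (by linarith)
  have hr1 : (3 - α) / (1 + α) < 1 := by
    rw [div_lt_one (by linarith)]
    linarith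
  have hlog : Real.log ((3 - α) / (1 + α)) < 0 := Real.log_neg hr hr1
  have hexp : Complex.exp ((Real.log ((3 - α) / (1 + α)) : ℝ) : ℂ)
      = (3 - (α : ℂ)) / (1 + (α : ℂ)) := by
    rw [← Complex.ofReal_exp, Real.exp_log hr]
    push_cast
    rfl
  have hα0 : (1 + (α : ℂ)) ≠ 0 := by
    exact_mod_cast (by linarith : (1 + α) ≠ 0)
  have hL0 : (L : ℂ) ≠ 0 := by exact_mod_cast hL.ne'
  ext z
  simp only [Set.mem_ofPred_eq]
  constructor
  · rintro ⟨hz, h⟩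
    rcases mul_eq_zero.mp h with h | h
    · have hn : ‖Complex.exp (z * L)‖ = 1 := by rw [sub_eq_zero.mp h, norm_one]
      rw [Complex.norm_exp, Real.exp_eq_one_iff, Complex.re_mul_ofReal] at hn
      exact absurd hn (mul_neg_of_neg_of_pos hz hL).ne
    · have he : Complex.exp (z * L)
          = Complex.exp ((Real.log ((3 - α) / (1 + α)) : ℝ) : ℂ) := by
        rw [hexp, eq_div_iff hα0]
        linear_combination h
      obtain ⟨n, hn⟩ := Complex.exp_eq_exp_iff_exists_int.mp he
      refine ⟨n, ?_⟩
      rw [eq_div_of_mul_eq hL0 hn]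
      push_cast
      ring
  · rintro ⟨n, rfl⟩
    refine ⟨?_, mul_eq_zero_of_right _ ?_⟩
    · rw [Complex.add_re, Complex.ofReal_re, Complex.re_ofReal_mul, Complex.I_re, mul_zero,
        add_zero]
      exact div_neg_of_neg_of_pos hlog hL
    · have he : Complex.exp ((((Real.log ((3 - α) / (1 + α)) / L : ℝ) : ℂ)
          + ((2 * Real.pi * (n : ℝ) / L : ℝ) : ℂ) * Complex.I) * L)
          = (3 - (α : ℂ)) / (1 + (α : ℂ)) := by
        rw [← hexp, Complex.exp_eq_exp_iff_exists_int]
        refine ⟨n, ?_⟩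
        rw [Complex.ofReal_div, Complex.ofReal_div, add_mul, div_mul_cancel₀ _ hL0,
          mul_right_comm, div_mul_cancel₀ _ hL0]
        push_cast
        ring
      rw [he, add_comm (α : ℂ) 1, mul_div_cancel₀ _ hα0, sub_self]
end

section
/- Let L > 0 and α > 3. Then { z ∈ ℂ : Re z < 0 and (e^{zL} − 1)·((α+1)·e^{zL} − (3−α)) = 0 } = { (1/L)·ln((α−3)/(1+α)) + ((2n+1)π/L)·i : n ∈ ℤ }. -/
theorem Complex.exp_eq_neg_ofReal_iff {r : ℝ} (hr : 0 < r) (w : ℂ) :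
    Complex.exp w = -(r : ℂ) ↔
      ∃ n : ℤ, w = (Real.log r : ℂ) + (2 * (n : ℂ) + 1) * Real.pi * Complex.I := by
  have h : -(r : ℂ) = Complex.exp ((Real.log r : ℂ) + Real.pi * Complex.I) := by
    rw [Complex.exp_add, Complex.exp_pi_mul_I, ← Complex.ofReal_exp, Real.exp_log hr]
    ring
  rw [h, Complex.exp_eq_exp_iff_exists_int]
  refine exists_congr fun n => ?_
  rw [show (Real.log r : ℂ) + Real.pi * Complex.I + n * (2 * Real.pi * Complex.I)
    = (Real.log r : ℂ) + (2 * (n : ℂ) + 1) * Real.pi * Complex.I by ring]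

theorem Complex.exp_ne_one_of_re_neg {w : ℂ} (hw : w.re < 0) : Complex.exp w ≠ 1 := by
  intro h
  have h_norm := Complex.norm_exp w
  rw [h, norm_one] at h_norm
  exact (Real.exp_lt_one_iff.2 hw).ne h_norm.symm


/-- For `L > 0` and `α > 3`, the solutions of
`(e^{zL} − 1)·((α+1)·e^{zL} − (3−α)) = 0` in the open left half-plane are exactly
`(1/L)·ln((α−3)/(1+α)) + ((2n+1)π/L)i`, `n ∈ ℤ`. -/
theorem stmt_10 (α L : ℝ) (hL : 0 < L) (hα : 3 < α) :
    {z : ℂ | z.re < 0 ∧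
        (Complex.exp (z * L) - 1) *
          (((α : ℂ) + 1) * Complex.exp (z * L) - (3 - (α : ℂ))) = 0}
      = {z : ℂ | ∃ n : ℤ,
          z = ((Real.log ((α - 3) / (1 + α)) / L : ℝ) : ℂ)
              + (((2 * (n : ℝ) + 1) * Real.pi / L : ℝ) : ℂ) * Complex.I} := by
  have hr : 0 < (α - 3) / (1 + α) := div_pos (by linarith) (by linarith)
  have hr_lt : (α - 3) / (1 + α) < 1 := (div_lt_one (by linarith)).2 (by linarith)
  have hL0 : (L : ℂ) ≠ 0 := Complex.ofReal_ne_zero.2 hL.ne'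
  have hα0 : (1 + α : ℂ) ≠ 0 := by
    exact_mod_cast (by linarith : (0 : ℝ) < 1 + α).ne'
  have factor (z : ℂ) : ((α : ℂ) + 1) * Complex.exp (z * L) - (3 - (α : ℂ)) = 0 ↔
      ∃ n : ℤ, z = ((Real.log ((α - 3) / (1 + α)) / L : ℝ) : ℂ)
        + (((2 * (n : ℝ) + 1) * Real.pi / L : ℝ) : ℂ) * Complex.I := by
    have h_exp : ((α : ℂ) + 1) * Complex.exp (z * L) - (3 - (α : ℂ)) = 0 ↔
        Complex.exp (z * L) = -(((α - 3) / (1 + α) : ℝ) : ℂ) := by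
      push_cast
      rw [← neg_div, eq_div_iff hα0, ← sub_eq_zero (b := -((α : ℂ) - 3))]
      ring_nf
    rw [h_exp, Complex.exp_eq_neg_ofReal_iff hr]
    refine exists_congr fun n => ?_
    rw [← eq_div_iff hL0, Complex.ofReal_div, Complex.ofReal_div]
    push_cast
    rw [add_div, div_mul_eq_mul_div]
  ext z
  simp only [Set.mem_ofPred_eq]
  constructor
  · rintro ⟨hz, h⟩
    have h_re : (z * L).re < 0 := by
      rw [Complex.re_mul_ofReal]
      exact mul_neg_of_neg_of_pos hz hL
    exact (factor z).1 ((mul_eq_zero.1 h).resolve_left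
      (sub_ne_zero.2 (Complex.exp_ne_one_of_re_neg h_re)))
  · intro h
    refine ⟨?_, mul_eq_zero.2 (Or.inr ((factor z).2 h))⟩
    obtain ⟨n, rfl⟩ := h
    rw [Complex.add_re, Complex.ofReal_re, Complex.re_ofReal_mul, Complex.I_re, mul_zero, add_zero]
    exact div_neg_of_neg_of_pos (Real.log_neg hr hr_lt) hL
end

section
/- Let α ∈ ℝ, L > 0, and n ∈ ℤ with n ≠ 0, and set z_n = 2πin/L. Define u₁ ≡ 0 on [0,∞) and u₂(x) = sin(2πnx/L) on [0,L], and set v_k = z_n·u_k for k = 1,2. Then u₂ is not identically zero, u_k'' = z_n²·u_k on each edge, the continuity conditions u₁(0) = u₂(0) = u₂(L) and v₁(0) = v₂(0) = v₂(L) hold, and the damped transmission condition u₁'(0) + u₂'(0) − u₂'(L) = α·v₁(0) holds. Hence z_n = 2πin/L is an eigenvalue of the damped wave operator 𝒜_α on the tadpole graph, embedded in the imaginary axis, for every α ∈ ℝ. -/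
open Set

/-- the embedded eigenvalue `z_n = 2πin/L` -/
noncomputable def zEmb (L : ℝ) (n : ℤ) : ℂ :=
  ((2 * Real.pi * (n : ℝ) / L : ℝ) : ℂ) * Complex.I

/-- the loop component `u₂(x) = sin(2πnx/L)` of the eigenfunction -/
noncomputable def uLoop (L : ℝ) (n : ℤ) (x : ℝ) : ℂ :=
  Complex.sin (((2 * Real.pi * (n : ℝ) * x / L : ℝ) : ℂ))

/-- its derivative `u₂'(x) = (2πn/L)·cos(2πnx/L)` -/
noncomputable def uLoop' (L : ℝ) (n : ℤ) (x : ℝ) : ℂ :=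
  ((2 * Real.pi * (n : ℝ) / L : ℝ) : ℂ) *
    Complex.cos (((2 * Real.pi * (n : ℝ) * x / L : ℝ) : ℂ))

theorem uLoop_zero (L : ℝ) (n : ℤ) : uLoop L n 0 = 0 := by
  simp [uLoop]

theorem uLoop_period {L : ℝ} (hL : L ≠ 0) (n : ℤ) : uLoop L n L = 0 := by
  have h : 2 * Real.pi * (n : ℝ) * L / L = ((2 * n : ℤ) : ℝ) * Real.pi := by
    push_cast
    field_simp
  rw [uLoop, h, ← Complex.ofReal_sin, Real.sin_int_mul_pi, Complex.ofReal_zero]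

theorem uLoop'_period {L : ℝ} (hL : L ≠ 0) (n : ℤ) : uLoop' L n L = uLoop' L n 0 := by
  have h : 2 * Real.pi * (n : ℝ) * L / L = (n : ℝ) * (2 * Real.pi) := by
    field_simp
  rw [uLoop', uLoop', h, ← Complex.ofReal_cos, Real.cos_int_mul_two_pi]
  simp

theorem hasDerivAt_uLoop_phase (L : ℝ) (n : ℤ) (x : ℝ) :
    HasDerivAt (fun x : ℝ => ((2 * Real.pi * (n : ℝ) * x / L : ℝ) : ℂ))
      ((2 * Real.pi * (n : ℝ) / L : ℝ) : ℂ) x := by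
  have h := ((hasDerivAt_id x).const_mul (2 * Real.pi * (n : ℝ))).div_const L
  rw [mul_one] at h
  exact h.ofReal_comp

theorem hasDerivAt_uLoop (L : ℝ) (n : ℤ) (x : ℝ) :
    HasDerivAt (uLoop L n) (uLoop' L n x) x := by
  have h := (Complex.hasDerivAt_sin _).comp x (hasDerivAt_uLoop_phase L n x)
  exact h.congr_deriv (mul_comm _ _)

theorem hasDerivAt_uLoop' (L : ℝ) (n : ℤ) (x : ℝ) :
    HasDerivAt (uLoop' L n) ((zEmb L n) ^ 2 * uLoop L n x) x := by
  have h := ((Complex.hasDerivAt_cos _).comp x (hasDerivAt_uLoop_phase L n x)).const_mul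
    ((2 * Real.pi * (n : ℝ) / L : ℝ) : ℂ)
  refine h.congr_deriv ?_
  rw [zEmb, uLoop, mul_pow, Complex.I_sq]
  ring

theorem exists_uLoop_ne_zero {L : ℝ} (hL : 0 < L) {n : ℤ} (hn : n ≠ 0) :
    ∃ x ∈ Icc (0 : ℝ) L, uLoop L n x ≠ 0 := by
  have hn' : (n : ℝ) ≠ 0 := Int.cast_ne_zero.mpr hn
  have habs : (1 : ℝ) ≤ |(n : ℝ)| := by
    exact_mod_cast Int.one_le_abs hn
  refine ⟨L / (4 * |(n : ℝ)|), ⟨by positivity, div_le_self hL.le (by linarith)⟩, ?_⟩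
  rw [uLoop, ← Complex.ofReal_sin, Complex.ofReal_ne_zero]
  rcases abs_choice (n : ℝ) with h | h <;> rw [h]
  · have : 2 * Real.pi * (n : ℝ) * (L / (4 * (n : ℝ))) / L = Real.pi / 2 := by
      field_simp
      norm_num
    rw [this, Real.sin_pi_div_two]
    exact one_ne_zero
  · have : 2 * Real.pi * (n : ℝ) * (L / (4 * -(n : ℝ))) / L = -(Real.pi / 2) := by
      field_simp
      norm_num
    rw [this, Real.sin_neg, Real.sin_pi_div_two]
    norm_num

/-- for every `α ∈ ℝ` and `n ∈ ℤ`, `n ≠ 0`, the pair `u = (0, sin(2πn·/L))`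
(with `v = z_n·u`) is a nontrivial eigenfunction of the damped wave operator `𝒜_α` on the
tadpole graph for the embedded eigenvalue `z_n = 2πin/L`: `u'' = z_n²·u` on each edge, the
vertex continuity conditions hold for `u` and `v = z_n u`, and the damped transmission
condition `u₁'(0) + u₂'(0) − u₂'(L) = α·(z_n·u₁(0))` holds. -/
theorem stmt_11 (α L : ℝ) (hL : 0 < L) (n : ℤ) (hn : n ≠ 0) :
    (∃ x ∈ Icc (0 : ℝ) L, uLoop L n x ≠ 0) ∧
    (∀ x : ℝ, HasDerivAt (fun _ : ℝ => (0 : ℂ)) 0 x) ∧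
    (∀ x : ℝ, HasDerivAt (fun _ : ℝ => (0 : ℂ)) ((zEmb L n) ^ 2 * 0) x) ∧
    (∀ x : ℝ, HasDerivAt (uLoop L n) (uLoop' L n x) x) ∧
    (∀ x : ℝ, HasDerivAt (uLoop' L n) ((zEmb L n) ^ 2 * uLoop L n x) x) ∧
    (0 : ℂ) = uLoop L n 0 ∧ uLoop L n 0 = uLoop L n L ∧
    zEmb L n * 0 = zEmb L n * uLoop L n 0 ∧
    zEmb L n * uLoop L n 0 = zEmb L n * uLoop L n L ∧
    (0 : ℂ) + uLoop' L n 0 - uLoop' L n L = (α : ℂ) * (zEmb L n * 0) := by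
  have hL' : L ≠ 0 := hL.ne'
  refine ⟨exists_uLoop_ne_zero hL hn, fun x => hasDerivAt_const x 0, fun x => ?_,
    hasDerivAt_uLoop L n, hasDerivAt_uLoop' L n, (uLoop_zero L n).symm, ?_, ?_, ?_, ?_⟩
  · rw [mul_zero]
    exact hasDerivAt_const x 0
  · rw [uLoop_zero, uLoop_period hL']
  · rw [uLoop_zero]
  · rw [uLoop_zero, uLoop_period hL']
  · rw [uLoop'_period hL']
    ring
end

section
/- Let α ∈ (1,3), L > 0, n ∈ ℤ, and set z = (1/L)·ln((3−α)/(1+α)) + (2πn/L)·i, so that Re z < 0. Define u₁(x) = e^{zx} on [0,∞) and u₂(x) = ((3−α)/4)·e^{−zx} + ((α+1)/4)·e^{zx} on [0,L]. Then u₁ and u₁' belong to L²(0,∞), u_k'' = z²·u_k on each edge, u₁(0) = u₂(0) = u₂(L) = 1, and u₁'(0) + u₂'(0) − u₂'(L) = α·z·u₁(0). Hence z is an eigenvalue of the damped wave operator 𝒜_α on the tadpole graph with eigenfunction (u, z·u). -/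
open Set MeasureTheory

/-- the discrete eigenvalue `z = (1/L)·ln((3−α)/(1+α)) + (2πn/L)i` for `α ∈ (1,3)` -/
noncomputable def zDisc (α L : ℝ) (n : ℤ) : ℂ :=
  ((Real.log ((3 - α) / (1 + α)) / L : ℝ) : ℂ)
    + ((2 * Real.pi * (n : ℝ) / L : ℝ) : ℂ) * Complex.I

/-- the half-line component `u₁(x) = e^{zx}` of the eigenfunction -/
noncomputable def uHalf (α L : ℝ) (n : ℤ) (x : ℝ) : ℂ :=
  Complex.exp (zDisc α L n * (x : ℂ))

/-- the loop component `u₂(x) = ((3−α)/4)·e^{−zx} + ((α+1)/4)·e^{zx}` -/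
noncomputable def uLoopD (α L : ℝ) (n : ℤ) (x : ℝ) : ℂ :=
  (((3 - α) / 4 : ℝ) : ℂ) * Complex.exp (-(zDisc α L n * (x : ℂ)))
    + (((α + 1) / 4 : ℝ) : ℂ) * Complex.exp (zDisc α L n * (x : ℂ))

/-- its derivative -/
noncomputable def uLoopD' (α L : ℝ) (n : ℤ) (x : ℝ) : ℂ :=
  -(zDisc α L n) * (((3 - α) / 4 : ℝ) : ℂ) * Complex.exp (-(zDisc α L n * (x : ℂ)))
    + zDisc α L n * (((α + 1) / 4 : ℝ) : ℂ) * Complex.exp (zDisc α L n * (x : ℂ))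

theorem re_zDisc (α L : ℝ) (n : ℤ) :
    (zDisc α L n).re = Real.log ((3 - α) / (1 + α)) / L := by
  simp only [zDisc, Complex.add_re, Complex.re_ofReal_mul, Complex.I_re, Complex.ofReal_re,
    mul_zero, add_zero]

theorem re_zDisc_neg {α L : ℝ} (hα : α ∈ Ioo (1 : ℝ) 3) (hL : 0 < L) (n : ℤ) :
    (zDisc α L n).re < 0 := by
  obtain ⟨h₁, h₃⟩ := hα
  rw [re_zDisc]
  refine div_neg_of_neg_of_pos (Real.log_neg (div_pos ?_ ?_) ?_) hL
  · linarith
  · linarith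
  · rw [div_lt_one] <;> linarith

theorem exp_zDisc_mul_self {α L : ℝ} (hα : α ∈ Ioo (1 : ℝ) 3) (hL : L ≠ 0) (n : ℤ) :
    Complex.exp (zDisc α L n * (L : ℂ)) = (3 - α) / (1 + α) := by
  obtain ⟨h₁, h₃⟩ := hα
  have hLc : (L : ℂ) ≠ 0 := Complex.ofReal_ne_zero.mpr hL
  have hpos : 0 < (3 - α) / (1 + α) := div_pos (by linarith) (by linarith)
  have hz : zDisc α L n * (L : ℂ) =
      (Real.log ((3 - α) / (1 + α)) : ℂ) + n * (2 * Real.pi * Complex.I) := by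
    simp only [zDisc]
    push_cast
    field_simp
  rw [hz, Complex.exp_add, Complex.exp_int_mul_two_pi_mul_I, mul_one, ← Complex.ofReal_exp,
    Real.exp_log hpos]
  push_cast
  rfl

theorem hasDerivAt_cexp_mul_ofReal (z : ℂ) (x : ℝ) :
    HasDerivAt (fun y : ℝ => Complex.exp (z * (y : ℂ))) (z * Complex.exp (z * (x : ℂ))) x := by
  have h : HasDerivAt (fun y : ℝ => z * (y : ℂ)) (z * 1) x :=
    (HasDerivAt.ofReal_comp (hasDerivAt_id x)).const_mul z
  refine h.cexp.congr_deriv ?_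
  ring

theorem hasDerivAt_exp_combination (z a b : ℂ) (x : ℝ) :
    HasDerivAt
      (fun y : ℝ => a * Complex.exp (-(z * (y : ℂ))) + b * Complex.exp (z * (y : ℂ)))
      (-z * a * Complex.exp (-(z * (x : ℂ))) + z * b * Complex.exp (z * (x : ℂ))) x := by
  have h := hasDerivAt_cexp_mul_ofReal (-z) x
  simp only [neg_mul] at h
  refine ((h.const_mul a).add ((hasDerivAt_cexp_mul_ofReal z x).const_mul b)).congr_deriv ?_
  ring

theorem integrableOn_norm_sq_cexp_mul {z : ℂ} (hz : z.re < 0) :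
    IntegrableOn (fun x : ℝ => ‖Complex.exp (z * (x : ℂ))‖ ^ 2) (Ioi 0) := by
  have h := integrableOn_exp_mul_Ioi (a := 2 * z.re) (by linarith) 0
  convert h using 2 with x
  rw [Complex.norm_exp, Complex.re_mul_ofReal, ← Real.exp_nat_mul]
  push_cast
  ring_nf

/-- for `α ∈ (1,3)`, `L > 0`, `n ∈ ℤ`, the number
`z = (1/L)·ln((3−α)/(1+α)) + (2πn/L)i` has `Re z < 0` and is an eigenvalue of the damped wave
operator `𝒜_α` on the tadpole graph, with eigenfunction `(u, z·u)` where
`u₁(x) = e^{zx}` and `u₂(x) = ((3−α)/4)e^{−zx} + ((α+1)/4)e^{zx}`: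
`u₁, u₁' ∈ L²(0,∞)`, `u'' = z²u` on each edge, `u₁(0) = u₂(0) = u₂(L) = 1`, and
`u₁'(0) + u₂'(0) − u₂'(L) = α·z·u₁(0)`. -/
theorem stmt_12 (α L : ℝ) (hα : α ∈ Set.Ioo (1 : ℝ) 3) (hL : 0 < L) (n : ℤ) :
    (zDisc α L n).re < 0 ∧
    IntegrableOn (fun x => ‖uHalf α L n x‖ ^ 2) (Ioi 0) ∧
    IntegrableOn (fun x => ‖zDisc α L n * uHalf α L n x‖ ^ 2) (Ioi 0) ∧
    (∀ x : ℝ, HasDerivAt (uHalf α L n) (zDisc α L n * uHalf α L n x) x) ∧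
    (∀ x : ℝ, HasDerivAt (fun y => zDisc α L n * uHalf α L n y)
        ((zDisc α L n) ^ 2 * uHalf α L n x) x) ∧
    (∀ x : ℝ, HasDerivAt (uLoopD α L n) (uLoopD' α L n x) x) ∧
    (∀ x : ℝ, HasDerivAt (uLoopD' α L n) ((zDisc α L n) ^ 2 * uLoopD α L n x) x) ∧
    uHalf α L n 0 = 1 ∧ uLoopD α L n 0 = 1 ∧ uLoopD α L n L = 1 ∧
    zDisc α L n * uHalf α L n 0 + uLoopD' α L n 0 - uLoopD' α L n L
      = (α : ℂ) * (zDisc α L n * uHalf α L n 0) := by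
  have hre := re_zDisc_neg hα hL n
  have hu : IntegrableOn (fun x => ‖uHalf α L n x‖ ^ 2) (Ioi 0) :=
    integrableOn_norm_sq_cexp_mul hre
  have hα₁ : (1 + α : ℂ) ≠ 0 := by
    have : (1 + α : ℝ) ≠ 0 := by linarith [hα.1]
    exact_mod_cast this
  have hα₃ : (3 - α : ℂ) ≠ 0 := by
    have : (3 - α : ℝ) ≠ 0 := by linarith [hα.2]
    exact_mod_cast this
  have hexp := exp_zDisc_mul_self hα hL.ne' n
  refine ⟨hre, hu, ?_, hasDerivAt_cexp_mul_ofReal _, fun x => ?_,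
    hasDerivAt_exp_combination _ _ _, fun x => ?_, ?_, ?_, ?_, ?_⟩
  · simp only [norm_mul, mul_pow]
    exact hu.const_mul _
  · rw [pow_two, mul_assoc]
    exact (hasDerivAt_cexp_mul_ofReal _ x).const_mul _
  · refine (hasDerivAt_exp_combination (zDisc α L n) (-zDisc α L n * ((3 - α) / 4 : ℝ))
      (zDisc α L n * ((α + 1) / 4 : ℝ)) x).congr_deriv ?_
    simp only [uLoopD]
    ring
  · simp [uHalf]
  · simp only [uLoopD, Complex.ofReal_zero, mul_zero, neg_zero, Complex.exp_zero]
    push_cast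
    ring
  · simp only [uLoopD, Complex.exp_neg, hexp]
    push_cast
    field_simp
    ring
  · simp only [uHalf, uLoopD', Complex.exp_neg, hexp, Complex.ofReal_zero, mul_zero,
      Complex.exp_zero, inv_one]
    push_cast
    field_simp
    ring
end

section
/- Let α ≥ 0, L > 0 and T > 0. Let u₁ : [0,∞)×[0,T] → ℂ and u₂ : [0,L]×[0,T] → ℂ be twice continuously differentiable solutions of the wave equation ∂²_t u_k = ∂²_x u_k on each edge, satisfying for every t ∈ [0,T] the vertex conditions u₁(0,t) = u₂(0,t) = u₂(L,t) and ∂_x u₁(0,t) + ∂_x u₂(0,t) − ∂_x u₂(L,t) = α·∂_t u₁(0,t). Assume moreover that for each t the functions ∂_x u₁(·,t), ∂_t u₁(·,t), ∂_x∂_t u₁(·,t), ∂²_x u₁(·,t) belong to L²(0,∞), with local uniformity in t, and that ∂_x u₁(x,t)·conj(∂_t u₁(x,t)) → 0 as x → ∞ for each t. Define the energy E(t) = ‖∂_x u₁(·,t)‖²_{L²(0,∞)} + ‖∂_x u₂(·,t)‖²_{L²(0,L)} + ‖∂_t u₁(·,t)‖²_{L²(0,∞)} + ‖∂_t u₂(·,t)‖²_{L²(0,L)}.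 Then for every t ∈ [0,T]: E(t) − E(0) = −2α·∫₀^t |∂_t u₁(0,s)|² ds. -/
open MeasureTheory Set Function ComplexConjugate

/-- partial derivative in the first (space) variable -/
noncomputable def pdx (u : ℝ → ℝ → ℂ) : ℝ → ℝ → ℂ := fun x t => deriv (fun y => u y t) x

/-- partial derivative in the second (time) variable -/
noncomputable def pdt (u : ℝ → ℝ → ℂ) : ℝ → ℝ → ℂ := fun x t => deriv (fun s => u x s) t

/-- the energy of the pair `(u₁,u₂)` at time `t` -/
noncomputable def tadpoleEnergy (L : ℝ) (u₁ u₂ : ℝ → ℝ → ℂ) (t : ℝ) : ℝ :=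
  (∫ x in Ioi (0 : ℝ), ‖pdx u₁ x t‖ ^ 2) + (∫ x in Ioo (0 : ℝ) L, ‖pdx u₂ x t‖ ^ 2)
    + (∫ x in Ioi (0 : ℝ), ‖pdt u₁ x t‖ ^ 2) + (∫ x in Ioo (0 : ℝ) L, ‖pdt u₂ x t‖ ^ 2)

section PartialDerivatives

variable {u : ℝ → ℝ → ℂ} {n : WithTop ℕ∞}

lemma hasDerivAt_pdx (hu : Differentiable ℝ (uncurry u)) (x t : ℝ) :
    HasDerivAt (fun y => u y t) (pdx u x t) x := by
  have h : DifferentiableAt ℝ (fun y => uncurry u (y, t)) x :=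
    by fun_prop
  exact h.hasDerivAt

lemma hasDerivAt_pdt (hu : Differentiable ℝ (uncurry u)) (x t : ℝ) :
    HasDerivAt (fun s => u x s) (pdt u x t) t := by
  have h : DifferentiableAt ℝ (fun s => uncurry u (x, s)) t :=
    by fun_prop
  exact h.hasDerivAt

lemma uncurry_pdx (hu : Differentiable ℝ (uncurry u)) :
    uncurry (pdx u) = fun p => fderiv ℝ (uncurry u) p (1, 0) := by
  ext ⟨x, t⟩
  exact ((hu (x, t)).hasFDerivAt.comp_hasDerivAt x
    ((hasDerivAt_id x).prodMk (hasDerivAt_const x t))).deriv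

lemma uncurry_pdt (hu : Differentiable ℝ (uncurry u)) :
    uncurry (pdt u) = fun p => fderiv ℝ (uncurry u) p (0, 1) := by
  ext ⟨x, t⟩
  exact ((hu (x, t)).hasFDerivAt.comp_hasDerivAt t
    ((hasDerivAt_const t x).prodMk (hasDerivAt_id t))).deriv

lemma contDiff_pdx (hu : ContDiff ℝ (n + 1) (uncurry u)) : ContDiff ℝ n (uncurry (pdx u)) := by
  rw [uncurry_pdx (hu.differentiable (by simp))]
  exact (hu.fderiv_right le_rfl).clm_apply contDiff_const

lemma contDiff_pdt (hu : ContDiff ℝ (n + 1) (uncurry u)) : ContDiff ℝ n (uncurry (pdt u)) := by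
  rw [uncurry_pdt (hu.differentiable (by simp))]
  exact (hu.fderiv_right le_rfl).clm_apply contDiff_const

lemma pdt_pdx_comm (hu : ContDiff ℝ 2 (uncurry u)) (x t : ℝ) :
    pdt (pdx u) x t = pdx (pdt u) x t := by
  have hd : Differentiable ℝ (uncurry u) := hu.differentiable (by simp)
  have hu' : ContDiff ℝ (1 + 1) (uncurry u) := by simpa [one_add_one_eq_two] using hu
  have hd2 : Differentiable ℝ (fderiv ℝ (uncurry u)) :=
    (hu'.fderiv_right le_rfl).differentiable (by simp)
  have hx := uncurry_pdt ((contDiff_pdx hu').differentiable (by simp))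
  have ht := uncurry_pdx ((contDiff_pdt hu').differentiable (by simp))
  rw [uncurry_pdx hd] at hx
  rw [uncurry_pdt hd] at ht
  have hx' := congrFun hx (x, t)
  have ht' := congrFun ht (x, t)
  simp only [uncurry_apply_pair] at hx' ht'
  rw [hx', ht', fderiv_clm_apply (hd2 _) (by fun_prop), fderiv_clm_apply (hd2 _) (by fun_prop)]
  simpa using (hu.contDiffAt (x := (x, t))).isSymmSndFDerivAt (by simp) (0, 1) (1, 0)

end PartialDerivatives

section EnergyDensity

/-- the energy density `|∂ₓu|² + |∂ₜu|²` -/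
noncomputable def energyDensity (u : ℝ → ℝ → ℂ) (x t : ℝ) : ℝ :=
  ‖pdx u x t‖ ^ 2 + ‖pdt u x t‖ ^ 2

/-- the energy flux `2 Re (∂ₓu · conj ∂ₜu)` -/
noncomputable def energyFlux (u : ℝ → ℝ → ℂ) (x t : ℝ) : ℝ :=
  2 * inner ℝ (pdx u x t) (pdt u x t)

/-- the space derivative of the energy flux -/
noncomputable def energyFluxDeriv (u : ℝ → ℝ → ℂ) (x t : ℝ) : ℝ :=
  2 * (inner ℝ (pdx u x t) (pdx (pdt u) x t) + inner ℝ (pdx (pdx u) x t) (pdt u x t))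

variable {u : ℝ → ℝ → ℂ} {S : Set ℝ} {t : ℝ}

lemma continuous_uncurry_energyDensity (hu : ContDiff ℝ 2 (uncurry u)) :
    Continuous (uncurry (energyDensity u)) := by
  have hu' : ContDiff ℝ (1 + 1) (uncurry u) := by simpa [one_add_one_eq_two] using hu
  exact ((contDiff_pdx hu').continuous.norm.pow 2).add ((contDiff_pdt hu').continuous.norm.pow 2)

lemma continuous_uncurry_energyFluxDeriv (hu : ContDiff ℝ 2 (uncurry u)) :
    Continuous (uncurry (energyFluxDeriv u)) := by
  have hu' : ContDiff ℝ (1 + 1) (uncurry u) := by simpa [one_add_one_eq_two] using hu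
  have hx : ContDiff ℝ (0 + 1) (uncurry (pdx u)) := by simpa using contDiff_pdx hu'
  have ht : ContDiff ℝ (0 + 1) (uncurry (pdt u)) := by simpa using contDiff_pdt hu'
  exact continuous_const.mul ((hx.continuous.inner (contDiff_pdx ht).continuous).add
    ((contDiff_pdx hx).continuous.inner ht.continuous))

lemma hasDerivAt_energyFlux (hu : ContDiff ℝ 2 (uncurry u)) (x t : ℝ) :
    HasDerivAt (fun y => energyFlux u y t) (energyFluxDeriv u x t) x := by
  have hu' : ContDiff ℝ (1 + 1) (uncurry u) := by simpa [one_add_one_eq_two] using hu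
  exact ((hasDerivAt_pdx ((contDiff_pdx hu').differentiable (by simp)) x t).inner ℝ
    (hasDerivAt_pdx ((contDiff_pdt hu').differentiable (by simp)) x t)).const_mul 2

lemma hasDerivAt_energyDensity (hu : ContDiff ℝ 2 (uncurry u)) {x t : ℝ}
    (hwave : pdt (pdt u) x t = pdx (pdx u) x t) :
    HasDerivAt (fun s => energyDensity u x s) (energyFluxDeriv u x t) t := by
  have hu' : ContDiff ℝ (1 + 1) (uncurry u) := by simpa [one_add_one_eq_two] using hu
  have h := (hasDerivAt_pdt ((contDiff_pdx hu').differentiable (by simp)) x t).norm_sq.add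
    (hasDerivAt_pdt ((contDiff_pdt hu').differentiable (by simp)) x t).norm_sq
  refine h.congr_deriv ?_
  rw [energyFluxDeriv, hwave, pdt_pdx_comm hu, real_inner_comm (pdx (pdx u) x t)]
  ring

lemma abs_energyFluxDeriv_le (u : ℝ → ℝ → ℂ) (x t : ℝ) :
    |energyFluxDeriv u x t| ≤ ‖pdx u x t‖ ^ 2 + ‖pdt u x t‖ ^ 2 + ‖pdx (pdt u) x t‖ ^ 2
      + ‖pdx (pdx u) x t‖ ^ 2 := by
  have h₁ := abs_real_inner_le_norm (pdx u x t) (pdx (pdt u) x t)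
  have h₂ := abs_real_inner_le_norm (pdx (pdx u) x t) (pdt u x t)
  have h₃ := abs_add_le (inner ℝ (pdx u x t) (pdx (pdt u) x t))
    (inner ℝ (pdx (pdx u) x t) (pdt u x t))
  rw [energyFluxDeriv, abs_mul, abs_two]
  nlinarith [sq_nonneg (‖pdx u x t‖ - ‖pdx (pdt u) x t‖),
    sq_nonneg (‖pdx (pdx u) x t‖ - ‖pdt u x t‖)]

/-- Energy balance: the energy on `S` changes at the rate of the total flux derivative. -/
lemma integral_energyDensity_sub (hu : ContDiff ℝ 2 (uncurry u)) (hS : MeasurableSet S)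
    (ht : 0 ≤ t) (hwave : ∀ x ∈ S, ∀ s ∈ Icc 0 t, pdt (pdt u) x s = pdx (pdx u) x s)
    {g : ℝ → ℝ} (hg : IntegrableOn g S)
    (hbound : ∀ x ∈ S, ∀ s ∈ Icc 0 t, |energyFluxDeriv u x s| ≤ g x)
    (hint : ∀ s ∈ Icc 0 t, IntegrableOn (fun x => energyDensity u x s) S) :
    (∫ x in S, energyDensity u x t) - ∫ x in S, energyDensity u x 0
      = ∫ s in (0 : ℝ)..t, ∫ x in S, energyFluxDeriv u x s := by
  have hcont := continuous_uncurry_energyFluxDeriv hu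
  have hprod : Integrable (uncurry (energyFluxDeriv u))
      ((volume.restrict S).prod (volume.restrict (Ioc 0 t))) := by
    refine Integrable.mono' (g := fun p => g p.1 * 1)
      (hg.mul_prod (integrable_const (1 : ℝ))) hcont.aestronglyMeasurable ?_
    rw [Measure.prod_restrict]
    filter_upwards [ae_restrict_mem (hS.prod measurableSet_Ioc)] with p hp
    rw [mul_one]
    exact hbound p.1 hp.1 p.2 (Ioc_subset_Icc_self hp.2)
  rw [← integral_sub (hint t ⟨ht, le_rfl⟩) (hint 0 ⟨le_rfl, ht⟩),
    intervalIntegral.integral_of_le ht, ← integral_integral_swap hprod]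
  refine setIntegral_congr_fun hS fun x hx => ?_
  rw [← intervalIntegral.integral_of_le ht]
  refine (intervalIntegral.integral_eq_sub_of_hasDerivAt (fun s hs => ?_) ?_).symm
  · rw [uIcc_of_le ht] at hs
    exact hasDerivAt_energyDensity hu (hwave x hx s hs)
  · exact (hcont.comp (by fun_prop : Continuous fun s : ℝ => (x, s))).intervalIntegrable _ _

lemma integral_Ioo_energyFluxDeriv (hu : ContDiff ℝ 2 (uncurry u)) {L : ℝ} (hL : 0 ≤ L) (s : ℝ) :
    ∫ x in Ioo 0 L, energyFluxDeriv u x s = energyFlux u L s - energyFlux u 0 s := by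
  rw [← integral_Ioc_eq_integral_Ioo, ← intervalIntegral.integral_of_le hL]
  exact intervalIntegral.integral_eq_sub_of_hasDerivAt
    (fun x _ => hasDerivAt_energyFlux hu x s)
    (((continuous_uncurry_energyFluxDeriv hu).comp
      (by fun_prop : Continuous fun x : ℝ => (x, s))).intervalIntegrable _ _)

lemma integral_Ioi_energyFluxDeriv (hu : ContDiff ℝ 2 (uncurry u)) {s : ℝ}
    (hint : IntegrableOn (fun x => energyFluxDeriv u x s) (Ioi 0))
    (hdecay : Filter.Tendsto (fun x => pdx u x s * conj (pdt u x s)) Filter.atTop (nhds 0)) :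
    ∫ x in Ioi (0 : ℝ), energyFluxDeriv u x s = -energyFlux u 0 s := by
  have hlim : Filter.Tendsto (fun x => energyFlux u x s) Filter.atTop (nhds 0) := by
    have h := ((Complex.continuous_re.tendsto 0).comp hdecay).const_mul 2
    simp only [Complex.zero_re, mul_zero] at h
    refine h.congr fun x => ?_
    simp only [comp_apply, energyFlux, Complex.inner, Complex.mul_re, Complex.conj_re,
      Complex.conj_im]
    ring
  simpa using integral_Ioi_of_hasDerivAt_of_tendsto' (a := 0)
    (fun x _ => hasDerivAt_energyFlux hu x s) hint hlim

lemma integrableOn_Ioo_of_continuous_uncurry {f : ℝ → ℝ → ℝ} (hf : Continuous (uncurry f))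
    (a b s : ℝ) : IntegrableOn (fun x => f x s) (Ioo a b) :=
  ((hf.comp (by fun_prop : Continuous fun x : ℝ => (x, s))).integrableOn_Icc).mono_set
    Ioo_subset_Icc_self

lemma integral_Ioo_energyDensity_sub (hu : ContDiff ℝ 2 (uncurry u)) {L : ℝ} (hL : 0 ≤ L)
    (ht : 0 ≤ t) (hwave : ∀ x ∈ Icc 0 L, ∀ s ∈ Icc 0 t, pdt (pdt u) x s = pdx (pdx u) x s) :
    (∫ x in Ioo 0 L, energyDensity u x t) - ∫ x in Ioo 0 L, energyDensity u x 0
      = ∫ s in (0 : ℝ)..t, (energyFlux u L s - energyFlux u 0 s) := by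
  obtain ⟨C, hC⟩ := (isCompact_Icc.prod isCompact_Icc).exists_bound_of_continuousOn
    (s := Icc 0 L ×ˢ Icc 0 t) (continuous_uncurry_energyFluxDeriv hu).continuousOn
  rw [integral_energyDensity_sub hu measurableSet_Ioo ht
    (fun x hx => hwave x (Ioo_subset_Icc_self hx)) (g := fun _ => C)
    (integrableOn_const (by simp)) (fun x hx s hs => hC (x, s) ⟨Ioo_subset_Icc_self hx, hs⟩)
    (fun s _ => integrableOn_Ioo_of_continuous_uncurry (continuous_uncurry_energyDensity hu) 0 L s)]
  simp_rw [integral_Ioo_energyFluxDeriv hu hL]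

lemma integral_Ioi_energyDensity_sub (hu : ContDiff ℝ 2 (uncurry u)) (ht : 0 ≤ t)
    (hwave : ∀ x ∈ Ici 0, ∀ s ∈ Icc 0 t, pdt (pdt u) x s = pdx (pdx u) x s)
    {g : ℝ → ℝ} (hg : IntegrableOn g (Ioi 0))
    (hbound : ∀ x ∈ Ioi 0, ∀ s ∈ Icc 0 t, |energyFluxDeriv u x s| ≤ g x)
    (hint : ∀ s ∈ Icc 0 t, IntegrableOn (fun x => energyDensity u x s) (Ioi 0))
    (hdecay : ∀ s ∈ Icc 0 t,
      Filter.Tendsto (fun x => pdx u x s * conj (pdt u x s)) Filter.atTop (nhds 0)) :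
    (∫ x in Ioi 0, energyDensity u x t) - ∫ x in Ioi 0, energyDensity u x 0
      = ∫ s in (0 : ℝ)..t, -energyFlux u 0 s := by
  rw [integral_energyDensity_sub hu measurableSet_Ioi ht
    (fun x hx => hwave x (Ioi_subset_Ici_self hx)) hg hbound hint]
  refine intervalIntegral.integral_congr fun s hs => ?_
  rw [uIcc_of_le ht] at hs
  refine integral_Ioi_energyFluxDeriv hu ?_ (hdecay s hs)
  refine Integrable.mono' hg ((continuous_uncurry_energyFluxDeriv hu).comp
    (by fun_prop : Continuous fun x : ℝ => (x, s))).aestronglyMeasurable ?_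
  filter_upwards [ae_restrict_mem measurableSet_Ioi] with x hx
  exact hbound x hx s hs

lemma continuous_energyFlux (hu : ContDiff ℝ 2 (uncurry u)) (x : ℝ) :
    Continuous (energyFlux u x) := by
  have hu' : ContDiff ℝ (1 + 1) (uncurry u) := by simpa [one_add_one_eq_two] using hu
  have hc : Continuous fun s : ℝ => (x, s) := by fun_prop
  exact continuous_const.mul (((contDiff_pdx hu').continuous.comp hc).inner
    ((contDiff_pdt hu').continuous.comp hc))

/-- Functions agreeing on a nondegenerate time interval have equal time derivatives there. -/
lemma pdt_eq_of_eqOn_Icc {v w : ℝ → ℝ → ℂ} (hv : Differentiable ℝ (uncurry v))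
    (hw : Differentiable ℝ (uncurry w)) {x y T : ℝ} (hT : 0 < T)
    (h : EqOn (v x) (w y) (Icc 0 T)) {s : ℝ} (hs : s ∈ Icc 0 T) : pdt v x s = pdt w y s :=
  (uniqueDiffOn_Icc hT s hs).eq_deriv _
    ((hasDerivAt_pdt hv x s).hasDerivWithinAt.congr (fun _ hr => (h hr).symm) (h hs).symm)
    (hasDerivAt_pdt hw y s).hasDerivWithinAt

lemma tadpoleEnergy_eq {L : ℝ} {u₁ u₂ : ℝ → ℝ → ℂ} (hu₂ : ContDiff ℝ 2 (uncurry u₂))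
    (hx : IntegrableOn (fun x => ‖pdx u₁ x t‖ ^ 2) (Ioi 0))
    (ht : IntegrableOn (fun x => ‖pdt u₁ x t‖ ^ 2) (Ioi 0)) :
    tadpoleEnergy L u₁ u₂ t
      = (∫ x in Ioi 0, energyDensity u₁ x t) + ∫ x in Ioo 0 L, energyDensity u₂ x t := by
  have hu' : ContDiff ℝ (1 + 1) (uncurry u₂) := by simpa [one_add_one_eq_two] using hu₂
  unfold energyDensity
  rw [integral_add hx ht, integral_add
    (integrableOn_Ioo_of_continuous_uncurry (f := fun x t => ‖pdx u₂ x t‖ ^ 2)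
      (by exact (contDiff_pdx hu').continuous.norm.pow 2) 0 L t)
    (integrableOn_Ioo_of_continuous_uncurry (f := fun x t => ‖pdt u₂ x t‖ ^ 2)
      (by exact (contDiff_pdt hu').continuous.norm.pow 2) 0 L t), tadpoleEnergy]
  ring

end EnergyDensity

/-- the energy identity
`E(t) − E(0) = −2α·∫₀^t |∂_t u₁(0,s)|² ds`
for twice continuously differentiable solutions of the damped wave system on the tadpole graph
(wave equation on each edge, continuity at the vertex, Kirchhoff condition with damping
`α·∂_t u₁(0,t)`), assuming square integrability on the half-line of `∂_x u₁`, `∂_t u₁`,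
`∂_x∂_t u₁`, `∂²_x u₁` locally uniformly (i.e. dominatedly) in `t`, and the decay
`∂_x u₁·conj(∂_t u₁) → 0` at spatial infinity. -/
theorem stmt_14 (α L T : ℝ) (hα : 0 ≤ α) (hL : 0 < L) (hT : 0 < T)
    (u₁ u₂ : ℝ → ℝ → ℂ)
    (hu₁ : ContDiff ℝ 2 (uncurry u₁)) (hu₂ : ContDiff ℝ 2 (uncurry u₂))
    -- wave equation on each edge
    (hwave₁ : ∀ x ∈ Ici (0 : ℝ), ∀ t ∈ Icc (0 : ℝ) T, pdt (pdt u₁) x t = pdx (pdx u₁) x t)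
    (hwave₂ : ∀ x ∈ Icc (0 : ℝ) L, ∀ t ∈ Icc (0 : ℝ) T, pdt (pdt u₂) x t = pdx (pdx u₂) x t)
    -- vertex conditions
    (hvert : ∀ t ∈ Icc (0 : ℝ) T, u₁ 0 t = u₂ 0 t ∧ u₂ 0 t = u₂ L t)
    (hkirch : ∀ t ∈ Icc (0 : ℝ) T,
      pdx u₁ 0 t + pdx u₂ 0 t - pdx u₂ L t = (α : ℂ) * pdt u₁ 0 t)
    -- square integrability on the half line, for each t
    (hL2 : ∀ t ∈ Icc (0 : ℝ) T,
      IntegrableOn (fun x => ‖pdx u₁ x t‖ ^ 2) (Ioi 0) ∧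
      IntegrableOn (fun x => ‖pdt u₁ x t‖ ^ 2) (Ioi 0) ∧
      IntegrableOn (fun x => ‖pdx (pdt u₁) x t‖ ^ 2) (Ioi 0) ∧
      IntegrableOn (fun x => ‖pdx (pdx u₁) x t‖ ^ 2) (Ioi 0))
    -- local uniformity in t: a common integrable dominating function
    (hdom : ∃ g : ℝ → ℝ, IntegrableOn g (Ioi 0) ∧ ∀ t ∈ Icc (0 : ℝ) T, ∀ x ∈ Ioi (0 : ℝ),
      ‖pdx u₁ x t‖ ^ 2 + ‖pdt u₁ x t‖ ^ 2 + ‖pdx (pdt u₁) x t‖ ^ 2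
        + ‖pdx (pdx u₁) x t‖ ^ 2 ≤ g x)
    -- decay at spatial infinity
    (hdecay : ∀ t ∈ Icc (0 : ℝ) T,
      Filter.Tendsto (fun x => pdx u₁ x t * conj (pdt u₁ x t)) Filter.atTop (nhds 0)) :
    ∀ t ∈ Icc (0 : ℝ) T,
      tadpoleEnergy L u₁ u₂ t - tadpoleEnergy L u₁ u₂ 0
        = -2 * α * ∫ s in (0 : ℝ)..t, ‖pdt u₁ 0 s‖ ^ 2 := by
  intro t ht
  obtain ⟨g, hg, hdom⟩ := hdom
  have hsub : Icc 0 t ⊆ Icc 0 T := Icc_subset_Icc_right ht.2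
  have h0 : (0 : ℝ) ∈ Icc 0 T := ⟨le_rfl, hT.le⟩
  have hd₁ : Differentiable ℝ (uncurry u₁) := hu₁.differentiable (by simp)
  have hd₂ : Differentiable ℝ (uncurry u₂) := hu₂.differentiable (by simp)
  have hhalf := integral_Ioi_energyDensity_sub hu₁ ht.1
    (fun x hx s hs => hwave₁ x hx s (hsub hs)) hg
    (fun x hx s hs => (abs_energyFluxDeriv_le u₁ x s).trans (hdom s (hsub hs) x hx))
    (fun s hs => (hL2 s (hsub hs)).1.add (hL2 s (hsub hs)).2.1)
    (fun s hs => hdecay s (hsub hs))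
  have hloop := integral_Ioo_energyDensity_sub hu₂ hL.le ht.1
    (fun x hx s hs => hwave₂ x hx s (hsub hs))
  have hc₁ := continuous_energyFlux hu₁ 0
  have hc₂ := continuous_energyFlux hu₂ 0
  have hc₂L := continuous_energyFlux hu₂ L
  rw [tadpoleEnergy_eq hu₂ (hL2 t ht).1 (hL2 t ht).2.1,
    tadpoleEnergy_eq hu₂ (hL2 0 h0).1 (hL2 0 h0).2.1, add_sub_add_comm, hhalf, hloop,
    ← intervalIntegral.integral_add (Continuous.intervalIntegrable (by fun_prop) _ _)
      (Continuous.intervalIntegrable (by fun_prop) _ _),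
    ← intervalIntegral.integral_const_mul]
  refine intervalIntegral.integral_congr fun s hs => ?_
  rw [uIcc_of_le ht.1] at hs
  have hv₀ : pdt u₂ 0 s = pdt u₁ 0 s :=
    pdt_eq_of_eqOn_Icc hd₂ hd₁ hT (fun r hr => (hvert r hr).1.symm) (hsub hs)
  have hvL : pdt u₂ L s = pdt u₁ 0 s :=
    pdt_eq_of_eqOn_Icc hd₂ hd₁ hT (fun r hr => ((hvert r hr).1.trans (hvert r hr).2).symm)
      (hsub hs)
  have hk := congrArg (fun z => inner ℝ z (pdt u₁ 0 s)) (hkirch s (hsub hs))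
  simp only [inner_sub_left, inner_add_left, ← Complex.real_smul, real_inner_smul_left,
    real_inner_self_eq_norm_sq] at hk
  simp only [energyFlux, hv₀, hvL]
  linear_combination -2 * hk
end

section
/- Fix α ∈ (1,3) and L > 0; set ω = (1/L)·ln((1+α)/(3−α)) > 0, ν = 2π/L, and for n ∈ ℤ let z_n = −ω + inν, u_{1,n}(x) = e^{z_n x} on [0,∞), u_{2,n}(x) = ((3−α)/4)·e^{−z_n x} + ((1+α)/4)·e^{z_n x} on [0,L], and K = ((3−α)/4)²·(e^{2ωL} − 1) + ((1+α)/4)²·(1 − e^{−2ωL}). Then for every n ∈ ℤ with n ≠ 0: ‖u_{1,n}‖²_{L²(0,∞)} = 1/(2ω), ‖u_{1,n}'‖²_{L²(0,∞)} = (ω² + ν²n²)/(2ω), ‖u_{2,n}‖²_{L²(0,L)} = K/(2ω), and ‖u_{2,n}'‖²_{L²(0,L)} = (ω² + ν²n²)·‖u_{2,n}‖²_{L²(0,L)}. Consequently, the pair Ψ_n = C_n·((u_{1,n},u_{2,n}),(z_n u_{1,n}, z_n u_{2,n})) satisfies ‖Ψ_n‖²_ℋ = C_n²·(1+K)·(ω²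 + ν²n²)/ω, so the choice C_n = (ω/((1+K)·(ω² + ν²n²)))^{1/2} gives ‖Ψ_n‖_ℋ = 1. -/
open MeasureTheory Set

/-- `ω = (1/L)·ln((1+α)/(3−α))` -/
noncomputable def om (α L : ℝ) : ℝ := Real.log ((1 + α) / (3 - α)) / L

/-- the discrete eigenvalue `z_n = −ω + i·n·(2π/L)` -/
noncomputable def zn (α L : ℝ) (n : ℤ) : ℂ :=
  ((-om α L : ℝ) : ℂ) + (((n : ℝ) * (2 * Real.pi / L) : ℝ) : ℂ) * Complex.I

/-- half-line component `u_{1,n}(x) = e^{z_n x}` -/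
noncomputable def u1n (α L : ℝ) (n : ℤ) (x : ℝ) : ℂ := Complex.exp (zn α L n * (x : ℂ))

/-- loop component `u_{2,n}(x) = ((3−α)/4)e^{−z_n x} + ((1+α)/4)e^{z_n x}` -/
noncomputable def u2n (α L : ℝ) (n : ℤ) (x : ℝ) : ℂ :=
  (((3 - α) / 4 : ℝ) : ℂ) * Complex.exp (-(zn α L n * (x : ℂ)))
    + (((1 + α) / 4 : ℝ) : ℂ) * Complex.exp (zn α L n * (x : ℂ))

/-- derivative of `u_{1,n}` -/
noncomputable def d1n (α L : ℝ) (n : ℤ) (x : ℝ) : ℂ := zn α L n * u1n α L n x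

/-- derivative of `u_{2,n}` -/
noncomputable def d2n (α L : ℝ) (n : ℤ) (x : ℝ) : ℂ :=
  -(zn α L n) * (((3 - α) / 4 : ℝ) : ℂ) * Complex.exp (-(zn α L n * (x : ℂ)))
    + zn α L n * (((1 + α) / 4 : ℝ) : ℂ) * Complex.exp (zn α L n * (x : ℂ))

/-- `K = ((3−α)/4)²(e^{2ωL} − 1) + ((1+α)/4)²(1 − e^{−2ωL})` -/
noncomputable def Kc (α L : ℝ) : ℝ :=
  ((3 - α) / 4) ^ 2 * (Real.exp (2 * om α L * L) - 1)
    + ((1 + α) / 4) ^ 2 * (1 - Real.exp (-(2 * om α L * L)))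

/-- `‖Ψ_n‖²_ℋ/C_n²`: the square of the energy norm of the (unnormalized) eigenfunction
`((u_{1,n},u_{2,n}),(z_n u_{1,n}, z_n u_{2,n}))` -/
noncomputable def normSum (α L : ℝ) (n : ℤ) : ℝ :=
  (∫ x in Ioi (0 : ℝ), ‖d1n α L n x‖ ^ 2) + (∫ x in Ioo (0 : ℝ) L, ‖d2n α L n x‖ ^ 2)
    + (∫ x in Ioi (0 : ℝ), ‖zn α L n * u1n α L n x‖ ^ 2)
    + (∫ x in Ioo (0 : ℝ) L, ‖zn α L n * u2n α L n x‖ ^ 2)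

theorem norm_zn_sq (α L : ℝ) (n : ℤ) :
    ‖zn α L n‖ ^ 2 = (om α L) ^ 2 + (2 * Real.pi / L) ^ 2 * (n : ℝ) ^ 2 := by
  rw [← Complex.normSq_eq_norm_sq, zn, Complex.normSq_add_mul_I]
  ring

theorem norm_add_exp_sq (z : ℂ) (a b x : ℝ) :
    ‖(a : ℂ) * Complex.exp (-(z * (x : ℂ))) + (b : ℂ) * Complex.exp (z * (x : ℂ))‖ ^ 2
      = a ^ 2 * Real.exp (-2 * z.re * x) + b ^ 2 * Real.exp (2 * z.re * x)
        + 2 * a * b * Real.cos (2 * z.im * x) := by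
  have h₁ : Real.exp (-2 * z.re * x) = Real.exp (-(z.re * x)) ^ 2 := by
    rw [← Real.exp_nat_mul]; congr 1; push_cast; ring
  have h₂ : Real.exp (2 * z.re * x) = Real.exp (z.re * x) ^ 2 := by
    rw [← Real.exp_nat_mul]; congr 1; push_cast; ring
  have h₃ : Real.cos (2 * z.im * x) = 2 * Real.cos (z.im * x) ^ 2 - 1 := by
    rw [← Real.cos_two_mul]; congr 1; ring
  have h₄ : Real.exp (-(z.re * x)) * Real.exp (z.re * x) = 1 := by
    rw [← Real.exp_add]; simp
  have h₅ := Real.sin_sq_add_cos_sq (z.im * x)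
  rw [← Complex.normSq_eq_norm_sq, Complex.normSq_apply, h₁, h₂, h₃]
  simp only [Complex.add_re, Complex.add_im, Complex.re_ofReal_mul, Complex.im_ofReal_mul,
    Complex.exp_re, Complex.exp_im, Complex.neg_re, Complex.neg_im, Complex.re_mul_ofReal,
    Complex.im_mul_ofReal, Real.cos_neg, Real.sin_neg]
  generalize Real.exp (-(z.re * x)) = p at *
  generalize Real.exp (z.re * x) = q at *
  generalize Real.cos (z.im * x) = c at *
  generalize Real.sin (z.im * x) = s at *
  linear_combination (a ^ 2 * p ^ 2 + b ^ 2 * q ^ 2 - 2 * a * b * p * q) * h₅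
    + 2 * a * b * (2 * c ^ 2 - 1) * h₄

theorem integral_norm_add_exp_sq {z : ℂ} {L : ℝ} (hL : 0 < L) (hre : z.re ≠ 0) (him : z.im ≠ 0)
    (hsin : Real.sin (2 * z.im * L) = 0) (a b : ℝ) :
    ∫ x in Ioo (0 : ℝ) L,
        ‖(a : ℂ) * Complex.exp (-(z * (x : ℂ))) + (b : ℂ) * Complex.exp (z * (x : ℂ))‖ ^ 2
      = (a ^ 2 * (1 - Real.exp (-2 * z.re * L)) + b ^ 2 * (Real.exp (2 * z.re * L) - 1))
          / (2 * z.re) := by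
  simp_rw [norm_add_exp_sq]
  rw [← integral_Ioc_eq_integral_Ioo, ← intervalIntegral.integral_of_le hL.le]
  have key : ∀ x ∈ uIcc 0 L, HasDerivAt (fun x : ℝ =>
      a ^ 2 * (Real.exp (-2 * z.re * x) / (-2 * z.re))
        + b ^ 2 * (Real.exp (2 * z.re * x) / (2 * z.re))
        + 2 * a * b * (Real.sin (2 * z.im * x) / (2 * z.im)))
      (a ^ 2 * Real.exp (-2 * z.re * x) + b ^ 2 * Real.exp (2 * z.re * x)
        + 2 * a * b * Real.cos (2 * z.im * x)) x := by
    intro x _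
    have lin : ∀ c : ℝ, HasDerivAt (fun x : ℝ => c * x) c x := fun c => by
      simpa using (hasDerivAt_id x).const_mul c
    refine HasDerivAt.congr_deriv (((((lin (-2 * z.re)).exp.div_const (-2 * z.re)).const_mul (a ^ 2)).add
      (((lin (2 * z.re)).exp.div_const (2 * z.re)).const_mul (b ^ 2))).add
      (((lin (2 * z.im)).sin.div_const (2 * z.im)).const_mul (2 * a * b))) ?_
    field_simp
  rw [intervalIntegral.integral_eq_sub_of_hasDerivAt key
    (Continuous.intervalIntegrable (by fun_prop) _ _), hsin]
  simp only [mul_zero, Real.exp_zero, Real.sin_zero, zero_div]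
  field_simp
  ring

theorem integral_norm_exp_sq {z : ℂ} (hre : z.re < 0) :
    ∫ x in Ioi (0 : ℝ), ‖Complex.exp (z * (x : ℂ))‖ ^ 2 = 1 / (-2 * z.re) := by
  have h : ∀ x : ℝ, ‖Complex.exp (z * (x : ℂ))‖ ^ 2 = Real.exp (2 * z.re * x) := fun x => by
    rw [Complex.norm_exp, Complex.re_mul_ofReal, ← Real.exp_nat_mul]
    congr 1; push_cast; ring
  simp_rw [h]
  rw [integral_exp_mul_Ioi (by linarith), mul_zero, Real.exp_zero]
  field_simp

theorem om_pos {α L : ℝ} (hα : α ∈ Ioo (1 : ℝ) 3) (hL : 0 < L) : 0 < om α L := by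
  obtain ⟨h₁, h₃⟩ := hα
  refine div_pos (Real.log_pos ?_) hL
  rw [lt_div_iff₀ (by linarith)]
  linarith

theorem Kc_nonneg {α L : ℝ} (hα : α ∈ Ioo (1 : ℝ) 3) (hL : 0 < L) : 0 ≤ Kc α L := by
  have h : 0 ≤ 2 * om α L * L := by have := om_pos hα hL; positivity
  have h₁ := Real.one_le_exp h
  have h₂ := Real.exp_le_one_iff.mpr (neg_nonpos.mpr h)
  exact add_nonneg (mul_nonneg (sq_nonneg _) (sub_nonneg.mpr h₁))
    (mul_nonneg (sq_nonneg _) (sub_nonneg.mpr h₂))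

/-- computation of the `L²` norms of the eigenfunctions `u_{1,n}, u_{2,n}`
associated to the discrete eigenvalue `z_n = −ω + inν` (`ν = 2π/L`), for `α ∈ (1,3)`,
and normalization of `Ψ_n` in the energy space. -/
theorem stmt_15 (α L : ℝ) (hα : α ∈ Set.Ioo (1 : ℝ) 3) (hL : 0 < L)
    (n : ℤ) (hn : n ≠ 0) :
    0 < om α L ∧
    (∫ x in Ioi (0 : ℝ), ‖u1n α L n x‖ ^ 2) = 1 / (2 * om α L) ∧
    (∫ x in Ioi (0 : ℝ), ‖d1n α L n x‖ ^ 2)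
      = ((om α L) ^ 2 + (2 * Real.pi / L) ^ 2 * (n : ℝ) ^ 2) / (2 * om α L) ∧
    (∫ x in Ioo (0 : ℝ) L, ‖u2n α L n x‖ ^ 2) = Kc α L / (2 * om α L) ∧
    (∫ x in Ioo (0 : ℝ) L, ‖d2n α L n x‖ ^ 2)
      = ((om α L) ^ 2 + (2 * Real.pi / L) ^ 2 * (n : ℝ) ^ 2)
          * ∫ x in Ioo (0 : ℝ) L, ‖u2n α L n x‖ ^ 2 ∧
    normSum α L n
      = (1 + Kc α L) * ((om α L) ^ 2 + (2 * Real.pi / L) ^ 2 * (n : ℝ) ^ 2) / om α L ∧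
    (Real.sqrt (om α L /
        ((1 + Kc α L) * ((om α L) ^ 2 + (2 * Real.pi / L) ^ 2 * (n : ℝ) ^ 2)))) ^ 2
      * normSum α L n = 1 := by
  have hω := om_pos hα hL
  have hK := Kc_nonneg hα hL
  have hre : (zn α L n).re = -om α L := by simp [zn]
  have him : (zn α L n).im = n * (2 * Real.pi / L) := by simp [zn]
  have him0 : (zn α L n).im ≠ 0 := by rw [him]; positivity
  have hsin : Real.sin (2 * (zn α L n).im * L) = 0 := by
    rw [him, ← Real.sin_int_mul_pi (4 * n)]
    congr 1
    push_cast
    field_simp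
    ring
  have loop := integral_norm_add_exp_sq hL (by rw [hre]; linarith) him0 hsin
  have e₁ : ∫ x in Ioi (0 : ℝ), ‖u1n α L n x‖ ^ 2 = 1 / (2 * om α L) := by
    simpa only [u1n, hre, neg_mul_neg] using
      integral_norm_exp_sq (z := zn α L n) (by rw [hre]; linarith)
  have e₂ : ∫ x in Ioo (0 : ℝ) L, ‖u2n α L n x‖ ^ 2 = Kc α L / (2 * om α L) := by
    simp only [u2n]
    rw [loop, hre, Kc, show -2 * -om α L * L = 2 * om α L * L by ring,
      show 2 * -om α L * L = -(2 * om α L * L) by ring]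
    field_simp
    ring
  have e₃ : ∫ x in Ioo (0 : ℝ) L, ‖d2n α L n x‖ ^ 2
      = ‖zn α L n‖ ^ 2 * ∫ x in Ioo (0 : ℝ) L, ‖u2n α L n x‖ ^ 2 := by
    have h : ∀ x, ‖d2n α L n x‖ ^ 2 = ‖zn α L n‖ ^ 2 *
        ‖((-((3 - α) / 4) : ℝ) : ℂ) * Complex.exp (-(zn α L n * (x : ℂ)))
          + (((1 + α) / 4 : ℝ) : ℂ) * Complex.exp (zn α L n * (x : ℂ))‖ ^ 2 := fun x => by
      rw [← mul_pow, ← norm_mul, d2n]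
      congr 2
      push_cast
      ring
    simp only [h, u2n]
    rw [integral_const_mul, loop, loop, neg_sq]
  have e₄ : ∫ x in Ioi (0 : ℝ), ‖zn α L n * u1n α L n x‖ ^ 2
      = ‖zn α L n‖ ^ 2 / (2 * om α L) := by
    simp only [norm_mul, mul_pow]
    rw [integral_const_mul, e₁, mul_one_div]
  have e₅ : ∫ x in Ioo (0 : ℝ) L, ‖zn α L n * u2n α L n x‖ ^ 2
      = ‖zn α L n‖ ^ 2 * (Kc α L / (2 * om α L)) := by
    simp only [norm_mul, mul_pow]
    rw [integral_const_mul, e₂]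
  have e₆ : normSum α L n = (1 + Kc α L) * ‖zn α L n‖ ^ 2 / om α L := by
    simp only [normSum, d1n]
    rw [e₃, e₄, e₅, e₂]
    field_simp
    ring
  rw [← norm_zn_sq]
  refine ⟨hω, e₁, e₄, e₂, e₃, e₆, ?_⟩
  have hz : 0 < ‖zn α L n‖ := norm_pos_iff.mpr fun h => him0 (by rw [h, Complex.zero_im])
  rw [e₆, Real.sq_sqrt (by positivity)]
  field_simp
end

section
/- Let α ∈ (1,3) ∪ (3,∞), L > 0, and let z ∈ ℂ satisfy Re z < 0 and (1+α)·e^{zL} = 3−α. Define u₂(x) = ((3−α)/4)·e^{−zx} + ((1+α)/4)·e^{zx} on [0,L]. Then for every m ∈ ℤ with m ≠ 0, setting μ = 2πm/L: ∫₀^L u₂'(x)·μ·cos(μx) dx − i·μ·z·∫₀^L u₂(x)·sin(μx) dx = 0. (Equivalently, in the energy inner product of the tadpole graph, each eigenfunction Ψ = ((e^{z·}, u₂), (z·e^{z·}, z·u₂)) of 𝒜_α associated to an eigenvalue z in the open left half-plane is orthogonal to each eigenfunction Φ_m = ((0, sin(2πm·/L)), (0, (2πim/L)·sin(2πm·/L)))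 associated to the embedded purely imaginary eigenvalue 2πim/L; hence the subspace ℋ_{p,α} is orthogonal to ℋ_p.) -/
open intervalIntegral

/-- The integral over `[0, L]` of a function that is odd about the midpoint vanishes. -/
theorem intervalIntegral_eq_zero_of_reflect_neg {L : ℝ} {f : ℝ → ℂ}
    (hf : ∀ x, f (L - x) = -f x) : ∫ x in (0 : ℝ)..L, f x = 0 := by
  have h := intervalIntegral.integral_comp_sub_left (a := 0) (b := L) f L
  simp only [hf, intervalIntegral.integral_neg, sub_self, sub_zero] at h
  exact CharZero.neg_eq_self_iff.mp h

/-- Reflecting the argument in a `2π / L`-periodic phase. -/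
theorem phase_reflect {L : ℝ} (hL : L ≠ 0) (m : ℤ) (x : ℝ) :
    ((2 * Real.pi * (m : ℝ) * (L - x) / L : ℝ) : ℂ)
      = m * (2 * Real.pi) - ((2 * Real.pi * (m : ℝ) * x / L : ℝ) : ℂ) := by
  have hL' : (L : ℂ) ≠ 0 := mod_cast hL
  push_cast
  field_simp

/-- orthogonality of the discrete eigenfunctions to the embedded ones on the
tadpole graph: if `Re z < 0`, `(1+α)e^{zL} = 3−α`, and
`u₂(x) = ((3−α)/4)e^{−zx} + ((α+1)/4)e^{zx}`, then for every `m ∈ ℤ`, `m ≠ 0`, with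
`μ = 2πm/L`: `∫₀^L u₂'(x)·μ·cos(μx) dx − i·μ·z·∫₀^L u₂(x)·sin(μx) dx = 0`. -/
theorem stmt_18 (α L : ℝ) (hα : α ∈ Set.Ioo (1 : ℝ) 3 ∪ Set.Ioi (3 : ℝ)) (hL : 0 < L)
    (z : ℂ) (hz : z.re < 0)
    (heig : (1 + (α : ℂ)) * Complex.exp (z * L) = 3 - (α : ℂ)) :
    ∀ m : ℤ, m ≠ 0 →
      (∫ x in (0 : ℝ)..L,
          (-z * (((3 - α) / 4 : ℝ) : ℂ) * Complex.exp (-(z * (x : ℂ)))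
            + z * (((α + 1) / 4 : ℝ) : ℂ) * Complex.exp (z * (x : ℂ)))
          * ((2 * Real.pi * (m : ℝ) / L : ℝ) : ℂ)
          * Complex.cos (((2 * Real.pi * (m : ℝ) * x / L : ℝ) : ℂ)))
        - Complex.I * ((2 * Real.pi * (m : ℝ) / L : ℝ) : ℂ) * z *
          (∫ x in (0 : ℝ)..L,
            ((((3 - α) / 4 : ℝ) : ℂ) * Complex.exp (-(z * (x : ℂ)))
              + (((α + 1) / 4 : ℝ) : ℂ) * Complex.exp (z * (x : ℂ)))
            * Complex.sin (((2 * Real.pi * (m : ℝ) * x / L : ℝ) : ℂ)))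
      = 0 := by
  intro m _
  have hB : (((α + 1) / 4 : ℝ) : ℂ) * Complex.exp (z * L) = (((3 - α) / 4 : ℝ) : ℂ) := by
    push_cast
    linear_combination heig / 4
  have hA : (((3 - α) / 4 : ℝ) : ℂ) * Complex.exp (-(z * L)) = (((α + 1) / 4 : ℝ) : ℂ) := by
    rw [← hB, mul_assoc, ← Complex.exp_add, add_neg_cancel, Complex.exp_zero, mul_one]
  have hminus (x : ℝ) : (((3 - α) / 4 : ℝ) : ℂ) * Complex.exp (-(z * ((L - x : ℝ) : ℂ)))
      = (((α + 1) / 4 : ℝ) : ℂ) * Complex.exp (z * x) := by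
    rw [← hA, mul_assoc, ← Complex.exp_add]
    congr 2
    push_cast
    ring
  have hplus (x : ℝ) : (((α + 1) / 4 : ℝ) : ℂ) * Complex.exp (z * ((L - x : ℝ) : ℂ))
      = (((3 - α) / 4 : ℝ) : ℂ) * Complex.exp (-(z * x)) := by
    rw [← hB, mul_assoc, ← Complex.exp_add]
    congr 2
    push_cast
    ring
  rw [intervalIntegral_eq_zero_of_reflect_neg, intervalIntegral_eq_zero_of_reflect_neg]
  · ring
  · intro x
    rw [hminus, hplus, phase_reflect hL.ne', Complex.sin_int_mul_two_pi_sub]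
    ring
  · intro x
    rw [mul_assoc (-z), mul_assoc z, hminus, hplus, phase_reflect hL.ne',
      Complex.cos_int_mul_two_pi_sub]
    ring
end
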